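/- arXiv:2512.20930 — 2 statements merged into one kernel-verified Lean document; each statement's English description precedes it below -/
import Mathlib

section
/- Let P be a countable right LCM monoid, H a separable complex Hilbert space, T a contractive representation of P on H, and S₁, S₂ contractions on H with S₁S₂ = S₂S₁ (no commutation between S₁, S₂ and T is assumed). Suppose that for each i = 1, 2 the representation S_i * T of the free product ℕ * P (sending the generator of ℕ to S_i and each p ∈ P to T(p)) admits a *-regular dilation. Then there exist a Hilbert space L containing H as a closed subspace, commuting isometries V₁, V₂ on L, and an isometric Nica-covariant representation W of P on L such that: (1) for every element x of the free product ℕ² * P, the compression to H of the image of x under the representation (V₁ × V₂) * W (sending the two commuting generators of ℕ² to V₁, V₂ and each p ∈ P to W(p)) equals the image of x under the representation (S₁ × S₂) * T (sending the generators of ℕ² to S₁, S₂ and each p ∈ P to T(p)); (2) for each i = 1, 2, the representation V_i * W of ℕ * P is an isometric Nica-covariant co-extension of S_i * T. -/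
open ContinuousLinearMap

universe u

/-- The right ideal `pP = {p * x : x ∈ P}` of a monoid. -/
def rightSet {M : Type*} [Monoid M] (p : M) : Set M := Set.range fun x => p * x

/-- A right LCM monoid: a left-cancellative monoid in which the intersection of two
principal right ideals is either empty or again a principal right ideal. -/
def IsRightLCMMonoid (M : Type*) [Monoid M] : Prop :=
  (∀ a b c : M, a * b = a * c → b = c) ∧
    ∀ p q : M, rightSet p ∩ rightSet q = ∅ ∨ ∃ r : M, rightSet p ∩ rightSet q = rightSet r

/-- Nica covariance for an (isometric) operator-valued map on a right LCM monoid. -/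
def IsNicaCovariant {M : Type*} [Monoid M] {K : Type*} [NormedAddCommGroup K]
    [InnerProductSpace ℂ K] [CompleteSpace K] (W : M → (K →L[ℂ] K)) : Prop :=
  ∀ p q : M,
    (rightSet p ∩ rightSet q = ∅ → W p * adjoint (W p) * (W q * adjoint (W q)) = 0) ∧
    ∀ r : M, rightSet p ∩ rightSet q = rightSet r →
      W p * adjoint (W p) * (W q * adjoint (W q)) = W r * adjoint (W r)

/-- A representation `T` of a monoid `M` on `H` has a `*`-regular dilation if there exist a
Hilbert space `K ⊇ H` (realized via an isometric embedding `ι : H → K`) and an isometric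
representation `V` of `M` on `K` such that `P_H V(p)* V(q)|_H = T(a) T(b)*` whenever
`pM ∩ qM = rM` with `r = pa = qb`, and `P_H V(p)* V(q)|_H = 0` whenever `pM ∩ qM = ∅`. -/
def HasStarRegularDilation {M : Type*} [Monoid M] {H : Type u} [NormedAddCommGroup H]
    [InnerProductSpace ℂ H] [CompleteSpace H] (T : M → (H →L[ℂ] H)) : Prop :=
  ∃ (K : Type u) (_ : NormedAddCommGroup K) (_ : InnerProductSpace ℂ K) (_ : CompleteSpace K)
    (ι : H →ₗᵢ[ℂ] K) (V : M → (K →L[ℂ] K)),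
    V 1 = 1 ∧ (∀ a b : M, V (a * b) = V a * V b) ∧ (∀ x : M, adjoint (V x) * V x = 1) ∧
    ∀ p q : M,
      (rightSet p ∩ rightSet q = ∅ →
        adjoint ι.toContinuousLinearMap ∘L
          ((adjoint (V p) * V q) ∘L ι.toContinuousLinearMap) = 0) ∧
      ∀ r a b : M, rightSet p ∩ rightSet q = rightSet r → r = p * a → r = q * b →
        adjoint ι.toContinuousLinearMap ∘L
            ((adjoint (V p) * V q) ∘L ι.toContinuousLinearMap) = T a * adjoint (T b)

/-- The homomorphism `Multiplicative (ℕ × ℕ) →* M` determined by two commuting elements,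
i.e. the representation of `ℕ²` sending `(n, m)` to `aⁿ bᵐ`. -/
def pairHom {M : Type*} [Monoid M] (a b : M) (h : a * b = b * a) :
    Multiplicative (ℕ × ℕ) →* M where
  toFun q := a ^ (Multiplicative.toAdd q).1 * b ^ (Multiplicative.toAdd q).2
  map_one' := by simp
  map_mul' x y := by
    have hc : Commute a b := h
    have key : b ^ (Multiplicative.toAdd x).2 * a ^ (Multiplicative.toAdd y).1 =
        a ^ (Multiplicative.toAdd y).1 * b ^ (Multiplicative.toAdd x).2 :=
      (hc.symm.pow_pow _ _)
    show a ^ (Multiplicative.toAdd x + Multiplicative.toAdd y).1 *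
          b ^ (Multiplicative.toAdd x + Multiplicative.toAdd y).2 = _
    rw [Prod.fst_add, Prod.snd_add, pow_add, pow_add, mul_assoc,
      ← mul_assoc (a ^ (Multiplicative.toAdd y).1), ← key, mul_assoc, ← mul_assoc]


/-! ## Combinatorics of right LCM monoids and of `ℕ ∗ P` -/

section Comb

variable {P : Type*} [Monoid P]

theorem rs_mem {p x : P} : x ∈ rightSet p ↔ ∃ y, p * y = x := Iff.rfl

theorem rs_self (p : P) : p ∈ rightSet p := ⟨1, mul_one p⟩

theorem rs_mul (p x : P) : p * x ∈ rightSet p := ⟨x, rfl⟩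

theorem rs_trans {p q x : P} (h : p ∈ rightSet q) (hx : x ∈ rightSet p) : x ∈ rightSet q := by
  obtain ⟨y, rfl⟩ := h
  obtain ⟨z, rfl⟩ := hx
  exact ⟨y * z, by simp [mul_assoc]⟩

/-- `pP ∩ qP = rP` with `r = pa = qb`. -/
def IsLcm (p q r a b : P) : Prop := rightSet p ∩ rightSet q = rightSet r ∧ r = p * a ∧ r = q * b

theorem lcm_cases (hP : IsRightLCMMonoid P) (p q : P) :
    rightSet p ∩ rightSet q = ∅ ∨ ∃ r a b, IsLcm p q r a b := by
  rcases hP.2 p q with h | ⟨r, h⟩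
  · exact Or.inl h
  · right
    have hr : r ∈ rightSet p ∩ rightSet q := h ▸ rs_self r
    obtain ⟨⟨a, ha⟩, ⟨b, hb⟩⟩ := hr
    exact ⟨r, a, b, h, ha.symm, hb.symm⟩

theorem isUnit_of_mul_eq_one_lc (hP : IsRightLCMMonoid P) {p q : P} (h : p * q = 1) :
    IsUnit p := by
  have : q * p = 1 := hP.1 p _ _ (by rw [← mul_assoc, h, one_mul, mul_one])
  exact ⟨⟨p, q, h, this⟩, rfl⟩

theorem isUnit_left_of_mul (hP : IsRightLCMMonoid P) {p q : P} (h : IsUnit (p * q)) :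
    IsUnit p := by
  obtain ⟨u, hu⟩ := h
  refine isUnit_of_mul_eq_one_lc hP (q := q * ↑u⁻¹) ?_
  rw [← mul_assoc, ← hu, Units.mul_inv]

/-- The action of `P` on words. -/
def actP : P →* Function.End (P × List P) where
  toFun p := fun x => (p * x.1, x.2)
  map_one' := by funext x; exact Prod.ext (one_mul _) rfl
  map_mul' a b := by funext x; exact Prod.ext (mul_assoc _ _ _) rfl

/-- The action of the generator of `ℕ` on words. -/
def actE : Function.End (P × List P) := fun x => (1, x.1 :: x.2)

/-- The action of `ℕ ∗ P` on words. -/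
def actM : Monoid.Coprod (Multiplicative ℕ) P →* Function.End (P × List P) :=
  Monoid.Coprod.lift (powersHom _ actE) actP

/-- The first `P`-letter of an element of `ℕ ∗ P`. -/
def firstP (x : Monoid.Coprod (Multiplicative ℕ) P) : P := (actM x ((1 : P), [])).1

/-- The generator of `ℕ` in `ℕ ∗ P`. -/
def genE : Monoid.Coprod (Multiplicative ℕ) P := Monoid.Coprod.inl (Multiplicative.ofAdd 1)

theorem firstP_inr_mul (p : P) (x : Monoid.Coprod (Multiplicative ℕ) P) :
    firstP (Monoid.Coprod.inr p * x) = p * firstP x := by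
  rw [firstP, actM, map_mul, Monoid.Coprod.lift_apply_inr]
  rfl

theorem firstP_genE_mul (x : Monoid.Coprod (Multiplicative ℕ) P) :
    firstP (genE * x) = 1 := by
  rw [firstP, actM, map_mul, genE, Monoid.Coprod.lift_apply_inl]
  simp only [powersHom_apply, toAdd_ofAdd, pow_one]
  rfl

/-- Induction principle on words. -/
theorem coprod_ind {motive : Monoid.Coprod (Multiplicative ℕ) P → Prop} (h1 : motive 1)
    (hE : ∀ x, motive x → motive (genE * x))
    (hr : ∀ p x, motive x → motive (Monoid.Coprod.inr p * x)) (x) : motive x := by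
  induction x using Monoid.Coprod.induction_on' with
  | one => exact h1
  | inr_mul p x hx => exact hr p x hx
  | inl_mul n x hx =>
    have : ∀ (k : ℕ), motive (Monoid.Coprod.inl (Multiplicative.ofAdd k) * x) := by
      intro k
      induction k with
      | zero => simpa using hx
      | succ k ih =>
        have h2 : (Monoid.Coprod.inl (Multiplicative.ofAdd (k + 1)) :
            Monoid.Coprod (Multiplicative ℕ) P) =
            genE * Monoid.Coprod.inl (Multiplicative.ofAdd k) := by
          rw [genE, ← map_mul, ← ofAdd_add, add_comm]
        rw [h2, mul_assoc]
        exact hE _ ih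
    exact this n.toAdd

theorem exists_firstP (x : Monoid.Coprod (Multiplicative ℕ) P) :
    ∃ y, x = Monoid.Coprod.inr (firstP x) * y := by
  induction x using coprod_ind with
  | h1 => exact ⟨1, by
      have : firstP (1 : Monoid.Coprod (Multiplicative ℕ) P) = 1 := by
        rw [firstP, map_one]; rfl
      simp [this]⟩
  | hE x _ => exact ⟨genE * x, by simp [firstP_genE_mul]⟩
  | hr p x hx =>
    obtain ⟨y, hy⟩ := hx
    refine ⟨y, ?_⟩
    rw [firstP_inr_mul, map_mul, mul_assoc, ← hy]

theorem inr_disj {p q : P} (h : rightSet p ∩ rightSet q = ∅) :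
    rightSet (Monoid.Coprod.inr p : Monoid.Coprod (Multiplicative ℕ) P) ∩
      rightSet (Monoid.Coprod.inr q) = ∅ := by
  rw [Set.eq_empty_iff_forall_notMem] at h ⊢
  rintro z ⟨⟨x, rfl⟩, ⟨y, hy⟩⟩
  apply h (p * firstP x)
  refine ⟨rs_mul _ _, ⟨firstP y, ?_⟩⟩
  have := congrArg firstP hy
  simpa [firstP_inr_mul] using this

theorem inr_lcm {p q r a b : P} (h : IsLcm p q r a b) :
    IsLcm (Monoid.Coprod.inr p : Monoid.Coprod (Multiplicative ℕ) P)
      (Monoid.Coprod.inr q) (Monoid.Coprod.inr r) (Monoid.Coprod.inr a)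
      (Monoid.Coprod.inr b) := by
  obtain ⟨h, ha, hb⟩ := h
  refine ⟨?_, by rw [ha, map_mul], by rw [hb, map_mul]⟩
  ext z
  constructor
  · rintro ⟨⟨x, rfl⟩, ⟨y, hy⟩⟩
    have h1 : p * firstP x ∈ rightSet p ∩ rightSet q := by
      refine ⟨rs_mul _ _, ⟨firstP y, ?_⟩⟩
      have := congrArg firstP hy
      simpa [firstP_inr_mul] using this
    rw [h] at h1
    obtain ⟨t, ht⟩ := h1
    obtain ⟨w, hw⟩ := exists_firstP x
    refine ⟨Monoid.Coprod.inr t * w, ?_⟩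
    simp only at ht ⊢
    conv_rhs => rw [hw]
    rw [← mul_assoc, ← map_mul, ht, map_mul, mul_assoc]
  · rintro ⟨x, rfl⟩
    constructor
    · exact ⟨Monoid.Coprod.inr a * x, by simp [ha, mul_assoc]⟩
    · exact ⟨Monoid.Coprod.inr b * x, by simp [hb, mul_assoc]⟩

theorem pe_qe_disj {p q : P} (h : p ≠ q) :
    rightSet (Monoid.Coprod.inr p * genE : Monoid.Coprod (Multiplicative ℕ) P) ∩
      rightSet (Monoid.Coprod.inr q * genE) = ∅ := by
  rw [Set.eq_empty_iff_forall_notMem]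
  rintro z ⟨⟨x, rfl⟩, ⟨y, hy⟩⟩
  have := congrArg firstP hy
  simp only [mul_assoc, firstP_inr_mul, firstP_genE_mul, mul_one] at this
  exact h this.symm

theorem pe_q_disj {p q : P} (h : p ∉ rightSet q) :
    rightSet (Monoid.Coprod.inr p * genE : Monoid.Coprod (Multiplicative ℕ) P) ∩
      rightSet (Monoid.Coprod.inr q) = ∅ := by
  rw [Set.eq_empty_iff_forall_notMem]
  rintro z ⟨⟨x, rfl⟩, ⟨y, hy⟩⟩
  have := congrArg firstP hy
  simp only [mul_assoc, firstP_inr_mul, firstP_genE_mul, mul_one] at this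
  exact h ⟨_, this⟩

theorem pe_q_lcm (q s : P) :
    IsLcm (Monoid.Coprod.inr (q * s) * genE : Monoid.Coprod (Multiplicative ℕ) P)
      (Monoid.Coprod.inr q) (Monoid.Coprod.inr (q * s) * genE) 1
      (Monoid.Coprod.inr s * genE) := by
  refine ⟨?_, by simp, by simp [mul_assoc]⟩
  rw [Set.inter_eq_left]
  intro x hx
  exact rs_trans ⟨Monoid.Coprod.inr s * genE, by simp [mul_assoc]⟩ hx

end Comb

set_option linter.unusedSectionVars false
set_option linter.unusedVariables false
set_option linter.unusedSimpArgs false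
/-! ## Nica-covariant representations, pointwise formulation -/

section Nica

variable {P : Type*} [Monoid P] {K : Type*} [NormedAddCommGroup K]
    [InnerProductSpace ℂ K] [CompleteSpace K]

/-- Pointwise form of: isometric and Nica-covariant. -/
structure NicaRep (W : P →* (K →L[ℂ] K)) : Prop where
  iso : ∀ p x, adjoint (W p) (W p x) = x
  disj : ∀ p q, rightSet p ∩ rightSet q = ∅ → ∀ x, adjoint (W p) (W q x) = 0
  lcm : ∀ p q r a b, IsLcm p q r a b → ∀ x, adjoint (W p) (W q x) = W a (adjoint (W b) x)

theorem hom_mul_apply (W : P →* (K →L[ℂ] K)) (p q : P) (x : K) : W (p * q) x = W p (W q x) := by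
  rw [map_mul]; rfl

theorem hom_adj_mul_apply (W : P →* (K →L[ℂ] K)) (p q : P) (x : K) :
    adjoint (W (p * q)) x = adjoint (W q) (adjoint (W p) x) := by
  rw [map_mul, mul_def, adjoint_comp]; rfl

theorem proj_sa (F : K →L[ℂ] K) (k z : K) :
    inner ℂ (F (adjoint F k)) z = inner ℂ k (F (adjoint F z)) := by
  rw [← adjoint_inner_right, adjoint_inner_left]

theorem hom_one_apply (W : P →* (K →L[ℂ] K)) (x : K) : W 1 x = x := by
  rw [map_one]; rfl

theorem adj_one_apply (W : P →* (K →L[ℂ] K)) (x : K) : adjoint (W 1) x = x := by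
  rw [map_one, one_def, adjoint_id]; rfl

theorem NicaRep.isNica {W : P →* (K →L[ℂ] K)} (hP : IsRightLCMMonoid P) (hW : NicaRep W) :
    IsNicaCovariant (fun p => W p) := by
  intro p q
  refine ⟨fun h => ?_, fun r h => ?_⟩
  · ext x
    change W p (adjoint (W p) (W q (adjoint (W q) x))) = 0
    rw [hW.disj p q h, map_zero]
  · ext x
    change W p (adjoint (W p) (W q (adjoint (W q) x))) = W r (adjoint (W r) x)
    have hr : r ∈ rightSet p ∩ rightSet q := h ▸ rs_self r
    obtain ⟨⟨a, ha⟩, ⟨b, hb⟩⟩ := hr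
    rw [hW.lcm p q r a b ⟨h, ha.symm, hb.symm⟩, ← hom_mul_apply, ← hom_adj_mul_apply]
    simp only at ha hb
    rw [ha, hb]

theorem NicaRep.unit_adj {W : P →* (K →L[ℂ] K)} (hW : NicaRep W) (u : Pˣ) (x : K) :
    adjoint (W (u : P)) x = W (↑u⁻¹ : P) x := by
  have h := hW.iso (u : P) (W (↑u⁻¹ : P) x)
  rwa [← hom_mul_apply, Units.mul_inv, hom_one_apply] at h

theorem NicaRep.adj_unit {W : P →* (K →L[ℂ] K)} (hW : NicaRep W) (u : Pˣ) (x : K) :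
    W (u : P) x = adjoint (W (↑u⁻¹ : P)) x := by
  rw [hW.unit_adj, inv_inv]

/-- `c` is orthogonal to the ranges of all non-invertible elements. -/
def Kill (W : P →* (K →L[ℂ] K)) (c : K) : Prop := ∀ p, ¬ IsUnit p → adjoint (W p) c = 0

theorem NicaRep.kill_notMem {W : P →* (K →L[ℂ] K)} (hP : IsRightLCMMonoid P) (hW : NicaRep W)
    {c : K} (hc : Kill W c) {p q : P} (h : p ∉ rightSet q) : adjoint (W q) (W p c) = 0 := by
  rcases lcm_cases hP q p with h0 | ⟨r, a, b, hl⟩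
  · exact hW.disj q p h0 c
  · rw [hW.lcm q p r a b hl]
    by_cases hb : IsUnit b
    · exfalso
      obtain ⟨u, rfl⟩ := hb
      apply h
      refine ⟨a * ↑u⁻¹, ?_⟩
      simp only
      rw [← mul_assoc, ← hl.2.1, hl.2.2, mul_assoc, Units.mul_inv, mul_one]
    · rw [hc b hb, map_zero]

theorem NicaRep.adj_mul {W : P →* (K →L[ℂ] K)} (hW : NicaRep W)
    (q s : P) (c : K) : adjoint (W q) (W (q * s) c) = W s c := by
  rw [hom_mul_apply, hW.iso]

/-- The pair `(V, W)` gives an isometric Nica-covariant representation of `ℕ ∗ P`. -/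
structure FreePair (W : P →* (K →L[ℂ] K)) (V : K →L[ℂ] K) : Prop where
  iso : ∀ x, adjoint V (V x) = x
  nonunit : ∀ p, ¬ IsUnit p → ∀ x, adjoint V (W p x) = 0
  ne_one : ∀ p, p ≠ 1 → ∀ x, adjoint V (W p (V x)) = 0

theorem FreePair.kill {W : P →* (K →L[ℂ] K)} {V : K →L[ℂ] K} (h : FreePair W V) (x : K) :
    Kill W (V x) := by
  intro p hp
  refine ext_inner_left ℂ fun y => ?_
  rw [adjoint_inner_right, inner_zero_right, ← adjoint_inner_left, h.nonunit p hp,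
    inner_zero_left]

/-- Representation of `ℕ ∗ P`. -/
noncomputable abbrev repM (W : P →* (K →L[ℂ] K)) (V : K →L[ℂ] K) :
    Monoid.Coprod (Multiplicative ℕ) P →* (K →L[ℂ] K) :=
  Monoid.Coprod.lift (powersHom (K →L[ℂ] K) V) W

theorem repM_genE (W : P →* (K →L[ℂ] K)) (V : K →L[ℂ] K) : repM W V genE = V := by
  simp [repM, genE]

theorem repM_inr (W : P →* (K →L[ℂ] K)) (V : K →L[ℂ] K) (p : P) :
    repM W V (Monoid.Coprod.inr p) = W p := by
  simp [repM]

theorem repM_iso {W : P →* (K →L[ℂ] K)} {V : K →L[ℂ] K} (hW : NicaRep W) (h : FreePair W V)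
    (x : Monoid.Coprod (Multiplicative ℕ) P) : ∀ y, adjoint (repM W V x) (repM W V x y) = y := by
  induction x using coprod_ind with
  | h1 => intro y; rw [hom_one_apply, adj_one_apply]
  | hE x hx => intro y; rw [hom_mul_apply, hom_adj_mul_apply, repM_genE, h.iso, hx]
  | hr p x hx => intro y; rw [hom_mul_apply, hom_adj_mul_apply, repM_inr, hW.iso, hx]

/-- The Nica dichotomy for a pair of elements. -/
def NicaAlt {M : Type*} [Monoid M] (F : M →* (K →L[ℂ] K)) (x y : M) : Prop :=
  (∀ k, adjoint (F x) (F y k) = 0) ∨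
    ∃ a b, x * a = y * b ∧ ∀ k, adjoint (F x) (F y k) = F a (adjoint (F b) k)

theorem isNica_of_alt {M : Type*} [Monoid M] {F : M →* (K →L[ℂ] K)}
    (hiso : ∀ x y, adjoint (F x) (F x y) = y) (h : ∀ x y, NicaAlt F x y) :
    IsNicaCovariant (fun x => F x) := by
  intro x y
  refine ⟨fun h0 => ?_, fun r hr => ?_⟩
  · ext k
    change F x (adjoint (F x) (F y (adjoint (F y) k))) = 0
    rcases h x y with h1 | ⟨a, b, hab, -⟩
    · rw [h1, map_zero]
    · exfalso
      have : x * a ∈ rightSet x ∩ rightSet y := ⟨rs_mul _ _, ⟨b, hab.symm⟩⟩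
      rw [h0] at this
      exact this
  · have hrm : r ∈ rightSet x ∩ rightSet y := hr ▸ rs_self r
    obtain ⟨⟨a', ha'⟩, ⟨b', hb'⟩⟩ := hrm
    simp only at ha' hb'
    have key : ∀ k, adjoint (F x) (F y (F b' k)) = F a' k := by
      intro k
      rw [← hom_mul_apply, hb', ← ha', hom_mul_apply, hiso]
    rcases h x y with h1 | ⟨a, b, hab, h2⟩
    · have hz : ∀ k : K, k = 0 := by
        intro k
        have h3 := key k
        rw [h1] at h3
        rw [← hiso a' k, ← h3, map_zero]
      ext k
      rw [hz k, map_zero, map_zero]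
    · have hs : x * a ∈ rightSet r := by
        rw [← hr]; exact ⟨rs_mul _ _, ⟨b, hab.symm⟩⟩
      obtain ⟨t, ht⟩ := hs
      simp only at ht
      ext k
      change F x (adjoint (F x) (F y (adjoint (F y) k))) = F r (adjoint (F r) k)
      have hpr : ∀ k, F x (adjoint (F x) (F y (adjoint (F y) k))) =
          F (x * a) (adjoint (F (x * a)) k) := by
        intro k
        rw [h2, ← hom_mul_apply, ← hom_adj_mul_apply, hab]
      -- both projections fix the range of the other
      have e1 : ∀ k, F (x * a) (adjoint (F (x * a)) (F r k)) = F r k := by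
        intro k
        rw [← hpr, ← hb', hom_mul_apply, hiso, key, ← hom_mul_apply, ← hom_mul_apply, ha', hb']
      have e2 : ∀ k, F r (adjoint (F r) (F (x * a) k)) = F (x * a) k := by
        intro k
        rw [← ht, hom_mul_apply, hiso]
      rw [hpr]
      refine ext_inner_right ℂ fun z => ?_
      calc inner ℂ (F (x * a) (adjoint (F (x * a)) k)) z
          = inner ℂ k (F (x * a) (adjoint (F (x * a)) z)) := proj_sa _ _ _
        _ = inner ℂ k (F r (adjoint (F r) (F (x * a) (adjoint (F (x * a)) z)))) := by rw [e2]
        _ = inner ℂ (F (x * a) (adjoint (F (x * a)) (F r (adjoint (F r) k)))) z := by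
            rw [proj_sa (F (x * a)), proj_sa (F r)]
        _ = inner ℂ (F r (adjoint (F r) k)) z := by rw [e1]

theorem alt_mul_left {M : Type*} [Monoid M] {F : M →* (K →L[ℂ] K)} {x y z : M}
    (h : (∀ k, adjoint (F x) (F z k) = 0) ∨
    ∃ a b, x * a = z * b ∧ (∀ k, adjoint (F x) (F z k) = F a (adjoint (F b) k)) ∧
      NicaAlt F y a) : NicaAlt F (x * y) z := by
  rcases h with h | ⟨a, b, hab, h, h'⟩
  · left; intro k; rw [hom_adj_mul_apply, h, map_zero]
  · rcases h' with h' | ⟨c, d, hcd, h'⟩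
    · left; intro k; rw [hom_adj_mul_apply, h, h']
    · right
      refine ⟨c, b * d, ?_, fun k => ?_⟩
      · rw [mul_assoc, hcd, ← mul_assoc, hab, mul_assoc]
      · rw [hom_adj_mul_apply, h, h', hom_adj_mul_apply]

theorem alt_mul_right {M : Type*} [Monoid M] {F : M →* (K →L[ℂ] K)} {x y z : M}
    (h : (∀ k, adjoint (F x) (F z k) = 0) ∨
    ∃ a b, x * a = z * b ∧ (∀ k, adjoint (F x) (F z k) = F a (adjoint (F b) k)) ∧
      NicaAlt F b y) : NicaAlt F x (z * y) := by
  rcases h with h | ⟨a, b, hab, h, h'⟩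
  · left; intro k; rw [hom_mul_apply, h]
  · rcases h' with h' | ⟨c, d, hcd, h'⟩
    · left; intro k; rw [hom_mul_apply, h, h', map_zero]
    · right
      refine ⟨a * c, d, ?_, fun k => ?_⟩
      · rw [← mul_assoc, hab, mul_assoc, hcd, mul_assoc]
      · rw [hom_mul_apply, h, h', hom_mul_apply]

theorem repM_alt_gen (hP : IsRightLCMMonoid P) {W : P →* (K →L[ℂ] K)} {V : K →L[ℂ] K}
    (hW : NicaRep W) (h : FreePair W V) (z : Monoid.Coprod (Multiplicative ℕ) P) :
    (∀ p : P, NicaAlt (repM W V) (Monoid.Coprod.inr p) z) ∧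
    (∀ u : Pˣ, NicaAlt (repM W V) (Monoid.Coprod.inr (u : P) * genE) z) := by
  have uu : ∀ u v : Pˣ, (Monoid.Coprod.inr (u : P) :
      Monoid.Coprod (Multiplicative ℕ) P) * Monoid.Coprod.inr (v : P) =
      Monoid.Coprod.inr ((u * v : Pˣ) : P) := by
    intro u v; rw [← map_mul, Units.val_mul]
  induction z using coprod_ind with
  | h1 =>
    refine ⟨fun p => Or.inr ⟨1, Monoid.Coprod.inr p, by simp, fun k => ?_⟩,
      fun u => Or.inr ⟨1, Monoid.Coprod.inr (u : P) * genE, by simp, fun k => ?_⟩⟩ <;>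
    rw [hom_one_apply, hom_one_apply]
  | hr q z hz =>
    refine ⟨fun p => alt_mul_right ?_, fun u => alt_mul_right ?_⟩
    · rcases lcm_cases hP p q with h0 | ⟨r, a, b, hl⟩
      · left; intro k; rw [repM_inr, repM_inr]; exact hW.disj p q h0 k
      · right
        refine ⟨Monoid.Coprod.inr a, Monoid.Coprod.inr b, ?_, fun k => ?_, hz.1 b⟩
        · rw [← map_mul, ← map_mul, ← hl.2.1, ← hl.2.2]
        · simp only [repM_inr]; exact hW.lcm p q r a b hl k
    · by_cases hq : IsUnit q
      · obtain ⟨v, rfl⟩ := hq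
        right
        refine ⟨1, Monoid.Coprod.inr ((v⁻¹ * u : Pˣ) : P) * genE, ?_, fun k => ?_, hz.2 _⟩
        · rw [← mul_assoc, uu, mul_inv_cancel_left, mul_one]
        · rw [hom_one_apply, hom_adj_mul_apply, hom_adj_mul_apply]
          simp only [repM_inr]
          rw [hW.unit_adj, hW.unit_adj, ← hom_mul_apply, ← Units.val_mul]
          rw [show u⁻¹ * v = (v⁻¹ * u)⁻¹ by group]
      · left
        intro k
        rw [hom_adj_mul_apply, repM_inr, repM_inr, repM_genE, hW.unit_adj, ← hom_mul_apply]
        apply h.nonunit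
        intro h3
        apply hq
        have := u.isUnit.mul h3
        rwa [← mul_assoc, Units.mul_inv, one_mul] at this
  | hE z hz =>
    refine ⟨fun p => alt_mul_right ?_, fun u => alt_mul_right ?_⟩
    · by_cases hp : IsUnit p
      · obtain ⟨v, rfl⟩ := hp
        right
        refine ⟨Monoid.Coprod.inr ((v⁻¹ : Pˣ) : P) * genE, 1, ?_, fun k => ?_, ?_⟩
        · rw [← mul_assoc, uu]; simp
        · rw [adj_one_apply, hom_mul_apply, repM_inr, repM_inr, repM_genE, hW.unit_adj]
        · have := hz.1 1
          rwa [map_one] at this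
      · left
        intro k
        rw [repM_inr, repM_genE]
        exact h.kill k p hp
    · by_cases hu : u = 1
      · right
        refine ⟨1, 1, by simp [hu], fun k => ?_, ?_⟩
        · rw [adj_one_apply, hom_one_apply, hu, Units.val_one, map_one, one_mul, repM_genE, h.iso]
        · have := hz.1 1
          rwa [map_one] at this
      · left
        intro k
        rw [hom_adj_mul_apply, repM_inr, repM_genE, hW.unit_adj]
        apply h.ne_one
        intro h3
        apply hu
        rw [← inv_eq_one, ← Units.val_eq_one, h3]

theorem repM_isNica (hP : IsRightLCMMonoid P) {W : P →* (K →L[ℂ] K)} {V : K →L[ℂ] K}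
    (hW : NicaRep W) (h : FreePair W V) : IsNicaCovariant (fun x => repM W V x) := by
  refine isNica_of_alt (repM_iso hW h) fun x => ?_
  induction x using coprod_ind with
  | h1 =>
    intro z
    have := (repM_alt_gen hP hW h z).1 1
    rwa [map_one] at this
  | hE x hx =>
    intro z
    apply alt_mul_left
    rcases (repM_alt_gen hP hW h z).2 1 with h1 | ⟨a, b, hab, h1⟩
    · left; simpa using h1
    · right; exact ⟨a, b, by simpa using hab, by simpa using h1, hx a⟩
  | hr p x hx =>
    intro z
    apply alt_mul_left
    rcases (repM_alt_gen hP hW h z).1 p with h1 | ⟨a, b, hab, h1⟩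
    · left; exact h1
    · right; exact ⟨a, b, hab, h1, hx a⟩

end Nica

/-! ## Co-extensions and the final assembly -/

section Coext

variable {H L : Type*} [NormedAddCommGroup H] [InnerProductSpace ℂ H] [CompleteSpace H]
  [NormedAddCommGroup L] [InnerProductSpace ℂ L] [CompleteSpace L]

/-- `a` on `L` is a co-extension of `a₀` on `H`. -/
def Coext (ι : H →ₗᵢ[ℂ] L) (a : L →L[ℂ] L) (a₀ : H →L[ℂ] H) : Prop :=
  ∀ h, adjoint a (ι h) = ι (adjoint a₀ h)

theorem Coext.one (ι : H →ₗᵢ[ℂ] L) : Coext ι 1 1 := by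
  intro h
  rw [one_def, one_def, adjoint_id, adjoint_id]; rfl

theorem Coext.mul {ι : H →ₗᵢ[ℂ] L} {a b : L →L[ℂ] L} {a₀ b₀ : H →L[ℂ] H} (ha : Coext ι a a₀)
    (hb : Coext ι b b₀) : Coext ι (a * b) (a₀ * b₀) := by
  intro h
  rw [mul_def, mul_def, adjoint_comp, adjoint_comp, comp_apply, comp_apply, ha, hb]

theorem Coext.pow {ι : H →ₗᵢ[ℂ] L} {a : L →L[ℂ] L} {a₀ : H →L[ℂ] H} (ha : Coext ι a a₀)
    (n : ℕ) : Coext ι (a ^ n) (a₀ ^ n) := by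
  induction n with
  | zero => simpa using Coext.one ι
  | succ n ih => rw [pow_succ, pow_succ]; exact ih.mul ha

theorem Coext.lift {A B : Type*} [Monoid A] [Monoid B] {ι : H →ₗᵢ[ℂ] L}
    {f : A →* (L →L[ℂ] L)} {g : B →* (L →L[ℂ] L)} {f₀ : A →* (H →L[ℂ] H)}
    {g₀ : B →* (H →L[ℂ] H)} (hf : ∀ a, Coext ι (f a) (f₀ a)) (hg : ∀ b, Coext ι (g b) (g₀ b))
    (x : Monoid.Coprod A B) :
    Coext ι (Monoid.Coprod.lift f g x) (Monoid.Coprod.lift f₀ g₀ x) := by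
  induction x using Monoid.Coprod.induction_on' with
  | one => rw [map_one, map_one]; exact Coext.one ι
  | inl_mul m x hx =>
    rw [map_mul, map_mul, Monoid.Coprod.lift_apply_inl, Monoid.Coprod.lift_apply_inl]
    exact (hf m).mul hx
  | inr_mul m x hx =>
    rw [map_mul, map_mul, Monoid.Coprod.lift_apply_inr, Monoid.Coprod.lift_apply_inr]
    exact (hg m).mul hx

theorem adj_iota (ι : H →ₗᵢ[ℂ] L) (h : H) : adjoint ι.toContinuousLinearMap (ι h) = h := by
  refine ext_inner_left ℂ fun y => ?_
  rw [adjoint_inner_right]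
  exact ι.inner_map_map y h

theorem Coext.compress {ι : H →ₗᵢ[ℂ] L} {a : L →L[ℂ] L} {a₀ : H →L[ℂ] H} (ha : Coext ι a a₀) :
    adjoint ι.toContinuousLinearMap ∘L (a ∘L ι.toContinuousLinearMap) = a₀ := by
  ext h
  refine ext_inner_left ℂ fun y => ?_
  change inner ℂ y (adjoint ι.toContinuousLinearMap (a (ι h))) = _
  rw [adjoint_inner_right]
  change inner ℂ (ι y) (a (ι h)) = _
  rw [← adjoint_inner_left, ha, ι.inner_map_map, adjoint_inner_left]

theorem Coext.range {ι : H →ₗᵢ[ℂ] L} {a : L →L[ℂ] L} {a₀ : H →L[ℂ] H} (ha : Coext ι a a₀)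
    (h : H) : adjoint a (ι h) ∈ Set.range ι := ⟨_, (ha h).symm⟩

end Coext

theorem final_assembly {P : Type u} [Monoid P] (hP : IsRightLCMMonoid P)
    {H : Type u} [NormedAddCommGroup H] [InnerProductSpace ℂ H] [CompleteSpace H]
    (T : P →* (H →L[ℂ] H)) (S₁ S₂ : H →L[ℂ] H) (hScomm : S₁ * S₂ = S₂ * S₁)
    {L : Type u} [NormedAddCommGroup L] [InnerProductSpace ℂ L] [CompleteSpace L]
    (ι : H →ₗᵢ[ℂ] L) (V₁ V₂ : L →L[ℂ] L) (hVcomm : V₁ * V₂ = V₂ * V₁) (W : P →* (L →L[ℂ] L))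
    (hW : NicaRep W) (h1 : FreePair W V₁) (h2 : FreePair W V₂) (c1 : Coext ι V₁ S₁)
    (c2 : Coext ι V₂ S₂) (cW : ∀ p, Coext ι (W p) (T p)) :
      adjoint V₁ * V₁ = 1 ∧ adjoint V₂ * V₂ = 1 ∧
      (∀ p : P, adjoint (W p) * W p = 1) ∧ IsNicaCovariant (fun p : P => W p) ∧
      (∀ x : Monoid.Coprod (Multiplicative (ℕ × ℕ)) P,
        adjoint ι.toContinuousLinearMap ∘L
            (Monoid.Coprod.lift (pairHom V₁ V₂ hVcomm) W x ∘L ι.toContinuousLinearMap) =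
          Monoid.Coprod.lift (pairHom S₁ S₂ hScomm) T x) ∧
      (∀ x : Monoid.Coprod (Multiplicative ℕ) P,
        adjoint (Monoid.Coprod.lift (powersHom (L →L[ℂ] L) V₁) W x) *
          Monoid.Coprod.lift (powersHom (L →L[ℂ] L) V₁) W x = 1) ∧
      (∀ x : Monoid.Coprod (Multiplicative ℕ) P,
        adjoint (Monoid.Coprod.lift (powersHom (L →L[ℂ] L) V₂) W x) *
          Monoid.Coprod.lift (powersHom (L →L[ℂ] L) V₂) W x = 1) ∧
      IsNicaCovariant
        (fun x : Monoid.Coprod (Multiplicative ℕ) P =>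
          Monoid.Coprod.lift (powersHom (L →L[ℂ] L) V₁) W x) ∧
      IsNicaCovariant
        (fun x : Monoid.Coprod (Multiplicative ℕ) P =>
          Monoid.Coprod.lift (powersHom (L →L[ℂ] L) V₂) W x) ∧
      (∀ (x : Monoid.Coprod (Multiplicative ℕ) P) (h : H),
        adjoint (Monoid.Coprod.lift (powersHom (L →L[ℂ] L) V₁) W x) (ι h) ∈ Set.range ι) ∧
      (∀ (x : Monoid.Coprod (Multiplicative ℕ) P) (h : H),
        adjoint (Monoid.Coprod.lift (powersHom (L →L[ℂ] L) V₂) W x) (ι h) ∈ Set.range ι) ∧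
      (∀ x : Monoid.Coprod (Multiplicative ℕ) P,
        adjoint ι.toContinuousLinearMap ∘L
            (Monoid.Coprod.lift (powersHom (L →L[ℂ] L) V₁) W x ∘L ι.toContinuousLinearMap) =
          Monoid.Coprod.lift (powersHom (H →L[ℂ] H) S₁) T x) ∧
      (∀ x : Monoid.Coprod (Multiplicative ℕ) P,
        adjoint ι.toContinuousLinearMap ∘L
            (Monoid.Coprod.lift (powersHom (L →L[ℂ] L) V₂) W x ∘L ι.toContinuousLinearMap) =
          Monoid.Coprod.lift (powersHom (H →L[ℂ] H) S₂) T x) := by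
  have e1 : ∀ x : Monoid.Coprod (Multiplicative ℕ) P,
      Coext ι (Monoid.Coprod.lift (powersHom (L →L[ℂ] L) V₁) W x)
        (Monoid.Coprod.lift (powersHom (H →L[ℂ] H) S₁) T x) :=
    Coext.lift (fun n => by simpa only [powersHom_apply] using c1.pow _) cW
  have e2 : ∀ x : Monoid.Coprod (Multiplicative ℕ) P,
      Coext ι (Monoid.Coprod.lift (powersHom (L →L[ℂ] L) V₂) W x)
        (Monoid.Coprod.lift (powersHom (H →L[ℂ] H) S₂) T x) :=
    Coext.lift (fun n => by simpa only [powersHom_apply] using c2.pow _) cW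
  have e12 : ∀ x : Monoid.Coprod (Multiplicative (ℕ × ℕ)) P,
      Coext ι (Monoid.Coprod.lift (pairHom V₁ V₂ hVcomm) W x)
        (Monoid.Coprod.lift (pairHom S₁ S₂ hScomm) T x) :=
    Coext.lift (fun n => (c1.pow _).mul (c2.pow _)) cW
  refine ⟨?_, ?_, ?_, hW.isNica hP, fun x => (e12 x).compress, ?_, ?_, repM_isNica hP hW h1,
    repM_isNica hP hW h2, fun x => (e1 x).range, fun x => (e2 x).range,
    fun x => (e1 x).compress, fun x => (e2 x).compress⟩
  · ext x; exact h1.iso x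
  · ext x; exact h2.iso x
  · intro p; ext x; exact hW.iso p x
  · intro x; ext y; exact repM_iso hW h1 x y
  · intro x; ext y; exact repM_iso hW h2 x y

set_option linter.unusedSectionVars false
/-! ## The minimal `*`-regular dilation of `T` -/

section StepA

variable {P : Type*} [Monoid P] {H K : Type*} [NormedAddCommGroup H] [InnerProductSpace ℂ H]
  [CompleteSpace H] [NormedAddCommGroup K] [InnerProductSpace ℂ K] [CompleteSpace K]

/-- Inner-product form of a `*`-regular dilation over `P`. -/
structure PReg (T : P →* (H →L[ℂ] H)) (ι : H →ₗᵢ[ℂ] K) (W : P →* (K →L[ℂ] K)) : Prop where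
  iso : ∀ p x, adjoint (W p) (W p x) = x
  disj : ∀ p q, rightSet p ∩ rightSet q = ∅ → ∀ h k, inner ℂ (W p (ι h)) (W q (ι k)) = 0
  lcm : ∀ p q r a b, IsLcm p q r a b → ∀ h k,
    inner ℂ (W p (ι h)) (W q (ι k)) = inner ℂ h (T a (adjoint (T b) k))

/-- The vectors `W p (ι h)` are total. -/
def TotalVec (ι : H →ₗᵢ[ℂ] K) (W : P →* (K →L[ℂ] K)) : Prop :=
  ∀ x, (∀ p h, inner ℂ (W p (ι h)) x = 0) → x = 0

theorem TotalVec.vec {ι : H →ₗᵢ[ℂ] K} {W : P →* (K →L[ℂ] K)} (ht : TotalVec ι W) {x y : K}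
    (h : ∀ p h, inner ℂ (W p (ι h)) x = inner ℂ (W p (ι h)) y) : x = y := by
  rw [← sub_eq_zero]
  exact ht _ fun p k => by rw [inner_sub_right, h, sub_self]

theorem TotalVec.op {E : Type*} [NormedAddCommGroup E] [InnerProductSpace ℂ E] [CompleteSpace E]
    {ι : H →ₗᵢ[ℂ] K} {W : P →* (K →L[ℂ] K)} (ht : TotalVec ι W) {A B : K →L[ℂ] E}
    (h : ∀ p h, A (W p (ι h)) = B (W p (ι h))) (x : K) : A x = B x := by
  refine ext_inner_right ℂ fun y => ?_
  rw [← adjoint_inner_right, ← adjoint_inner_right]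
  congr 1
  refine ht.vec fun p k => ?_
  rw [adjoint_inner_right, adjoint_inner_right, h]

theorem IsLcm.disj_mul (hP : IsRightLCMMonoid P) {p q r a b s : P} (h : IsLcm p q r a b)
    (hd : rightSet s ∩ rightSet a = ∅) : rightSet (p * s) ∩ rightSet q = ∅ := by
  rw [Set.eq_empty_iff_forall_notMem] at hd ⊢
  rintro z ⟨⟨x, rfl⟩, hz⟩
  have : p * s * x ∈ rightSet r := by
    rw [← h.1]; exact ⟨⟨s * x, by simp [mul_assoc]⟩, hz⟩
  obtain ⟨y, hy⟩ := this
  simp only at hy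
  rw [h.2.1, mul_assoc, mul_assoc] at hy
  exact hd (s * x) ⟨⟨x, rfl⟩, ⟨y, hP.1 _ _ _ hy⟩⟩

theorem disj_mul_left {p q s : P} (hd : rightSet p ∩ rightSet q = ∅) :
    rightSet (p * s) ∩ rightSet q = ∅ := by
  rw [Set.eq_empty_iff_forall_notMem] at hd ⊢
  rintro z ⟨⟨x, rfl⟩, hz⟩
  exact hd _ ⟨⟨s * x, by simp [mul_assoc]⟩, hz⟩

theorem IsLcm.mul_left (hP : IsRightLCMMonoid P) {p q r a b s m c d : P} (h : IsLcm p q r a b)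
    (h' : IsLcm s a m c d) : IsLcm (p * s) q (p * m) c (b * d) := by
  refine ⟨?_, by rw [h'.2.1, mul_assoc], ?_⟩
  · ext z
    constructor
    · rintro ⟨⟨x, rfl⟩, hz⟩
      have : p * s * x ∈ rightSet r := by
        rw [← h.1]; exact ⟨⟨s * x, by simp [mul_assoc]⟩, hz⟩
      obtain ⟨y, hy⟩ := this
      simp only at hy
      rw [h.2.1, mul_assoc, mul_assoc] at hy
      have h2 : s * x ∈ rightSet s ∩ rightSet a := ⟨⟨x, rfl⟩, ⟨y, hP.1 _ _ _ hy⟩⟩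
      rw [h'.1] at h2
      obtain ⟨t, ht⟩ := h2
      exact ⟨t, by simp only at ht ⊢; rw [mul_assoc, ht, mul_assoc]⟩
    · rintro ⟨x, rfl⟩
      refine ⟨⟨c * x, by simp [h'.2.1, mul_assoc]⟩, ⟨b * d * x, ?_⟩⟩
      simp only
      rw [← mul_assoc, ← mul_assoc, ← h.2.2, h.2.1, h'.2.2, mul_assoc p a d]
  · rw [h'.2.2, ← mul_assoc, ← h.2.1, h.2.2, mul_assoc]

theorem IsLcm.symm {p q r a b : P} (h : IsLcm p q r a b) : IsLcm q p r b a :=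
  ⟨by rw [Set.inter_comm, h.1], h.2.2, h.2.1⟩

variable {T : P →* (H →L[ℂ] H)} {ι : H →ₗᵢ[ℂ] K} {W : P →* (K →L[ℂ] K)}

theorem PReg.disj_apply (h : PReg T ι W) (ht : TotalVec ι W) {p q : P}
    (hd : rightSet p ∩ rightSet q = ∅) (k : H) : adjoint (W p) (W q (ι k)) = 0 := by
  refine ht _ fun s l => ?_
  rw [adjoint_inner_right, ← hom_mul_apply]
  exact h.disj _ _ (disj_mul_left hd) _ _

theorem PReg.lcm_apply (hP : IsRightLCMMonoid P) (h : PReg T ι W) (ht : TotalVec ι W) {p q r a b : P}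
    (hl : IsLcm p q r a b) (k : H) :
    adjoint (W p) (W q (ι k)) = W a (ι (adjoint (T b) k)) := by
  refine ht.vec fun s l => ?_
  rw [adjoint_inner_right, ← hom_mul_apply]
  rcases lcm_cases hP s a with hd | ⟨m, c, d, hm⟩
  · rw [h.disj _ _ hd, h.disj _ _ (hl.disj_mul hP hd)]
  · rw [h.lcm _ _ _ _ _ hm, h.lcm _ _ _ _ _ (hl.mul_left hP hm), hom_adj_mul_apply]

theorem isLcm_one (p : P) : IsLcm p 1 p 1 p := by
  refine ⟨?_, by simp, by simp⟩
  rw [Set.inter_eq_left]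
  intro x _
  exact ⟨x, by simp⟩

theorem PReg.coext (hP : IsRightLCMMonoid P) (h : PReg T ι W) (ht : TotalVec ι W) (p : P) :
    Coext ι (W p) (T p) := by
  intro k
  have := h.lcm_apply hP ht (isLcm_one p) k
  rwa [hom_one_apply, hom_one_apply] at this

theorem PReg.nica (hP : IsRightLCMMonoid P) (h : PReg T ι W) (ht : TotalVec ι W) : NicaRep W := by
  refine ⟨h.iso, fun p q hd => ?_, fun p q r a b hl => ?_⟩
  · refine ht.op (A := adjoint (W p) ∘L W q) (B := 0) fun x k => ?_
    rw [comp_apply, ← hom_mul_apply, zero_apply]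
    rw [Set.inter_comm] at hd
    refine h.disj_apply ht ?_ k
    rw [Set.inter_comm]
    exact disj_mul_left hd
  · refine ht.op (A := adjoint (W p) ∘L W q) (B := W a ∘L adjoint (W b)) fun x k => ?_
    rw [comp_apply, ← hom_mul_apply, comp_apply]
    rcases lcm_cases hP x b with hd | ⟨m, c, d, hm⟩
    · rw [h.disj_apply ht (p := b) (by rwa [Set.inter_comm]), map_zero]
      refine h.disj_apply ht ?_ k
      rw [Set.inter_comm]
      exact hl.symm.disj_mul hP hd
    · rw [h.lcm_apply hP ht hm.symm, h.lcm_apply hP ht (hl.symm.mul_left hP hm).symm,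
        hom_mul_apply]

/-- Vectors orthogonal to the minimal dilation space. -/
def orthPart (ι : H →ₗᵢ[ℂ] K) (W : P →* (K →L[ℂ] K)) : Submodule ℂ K where
  carrier := {x | ∀ p h, inner ℂ (W p (ι h)) x = 0}
  zero_mem' := by intro p h; exact inner_zero_right _
  add_mem' := by
    intro a b ha hb p h
    rw [inner_add_right, ha, hb, add_zero]
  smul_mem' := by
    intro c x hx p h
    rw [inner_smul_right, hx, mul_zero]

theorem vec_mem (ι : H →ₗᵢ[ℂ] K) (W : P →* (K →L[ℂ] K)) (p : P) (h : H) :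
    W p (ι h) ∈ (orthPart ι W)ᗮ := by
  rw [Submodule.mem_orthogonal']
  intro x hx
  exact hx p h

theorem W_mem (ι : H →ₗᵢ[ℂ] K) (W : P →* (K →L[ℂ] K)) (p : P) (y : K)
    (hy : y ∈ (orthPart ι W)ᗮ) : W p y ∈ (orthPart ι W)ᗮ := by
  rw [Submodule.mem_orthogonal] at hy ⊢
  intro x hx
  rw [← adjoint_inner_left]
  apply hy
  intro q h
  rw [adjoint_inner_right, ← hom_mul_apply]
  exact hx _ _

end StepA

theorem stepA {P : Type*} [Monoid P] {H K : Type u} [NormedAddCommGroup H]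
    [InnerProductSpace ℂ H] [CompleteSpace H] [NormedAddCommGroup K] [InnerProductSpace ℂ K]
    [CompleteSpace K] {T : P →* (H →L[ℂ] H)} {ι : H →ₗᵢ[ℂ] K} {W : P →* (K →L[ℂ] K)}
    (h : PReg T ι W) :
    ∃ (L : Type u) (_ : NormedAddCommGroup L) (_ : InnerProductSpace ℂ L) (_ : CompleteSpace L)
      (ι' : H →ₗᵢ[ℂ] L) (W' : P →* (L →L[ℂ] L)), PReg T ι' W' ∧ TotalVec ι' W' := by
  let N := orthPart ι W
  have hι : ∀ h, ι h ∈ Nᗮ := fun h => by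
    have := vec_mem ι W 1 h
    rwa [hom_one_apply] at this
  let ι' : H →ₗᵢ[ℂ] Nᗮ :=
    { toLinearMap := ι.toLinearMap.codRestrict Nᗮ hι
      norm_map' := fun x => ι.norm_map x }
  let W' : P →* (Nᗮ →L[ℂ] Nᗮ) :=
    { toFun := fun p => (W p ∘L Nᗮ.subtypeL).codRestrict Nᗮ (fun x => W_mem ι W p x x.2)
      map_one' := by
        ext x
        exact hom_one_apply W (x : K)
      map_mul' := by
        intro p q
        ext x
        exact hom_mul_apply W p q (x : K) }
  refine ⟨Nᗮ, inferInstance, inferInstance, inferInstance, ι', W', ⟨?_, ?_, ?_⟩, ?_⟩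
  · intro p x
    refine ext_inner_left ℂ fun y => ?_
    rw [adjoint_inner_right]
    change inner ℂ (W p y) (W p x) = inner ℂ (y : K) (x : K)
    rw [← adjoint_inner_right, h.iso]
  · intro p q hd a b
    exact h.disj p q hd a b
  · intro p q r a b hl x y
    exact h.lcm p q r a b hl x y
  · intro x hx
    have hxN : (x : K) ∈ N := fun p k => hx p k
    have : inner ℂ (x : K) (x : K) = 0 := Submodule.mem_orthogonal _ _ |>.1 x.2 _ hxN
    exact Subtype.ext (inner_self_eq_zero.1 this)

set_option linter.unusedSectionVars false
/-! ## Partial isometries from equal Gram matrices -/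

section Gram

variable {E F : Type*} [NormedAddCommGroup E] [InnerProductSpace ℂ E]
  [CompleteSpace E] [NormedAddCommGroup F] [InnerProductSpace ℂ F] [CompleteSpace F]

theorem orth_ext {I : Type*} (v : I → E) {A B : E →L[ℂ] F} (h : ∀ i, A (v i) = B (v i))
    (hA : ∀ x, (∀ i, inner ℂ (v i) x = 0) → A x = 0)
    (hB : ∀ x, (∀ i, inner ℂ (v i) x = 0) → B x = 0) : A = B := by
  have key : ∀ y, adjoint (A - B) y = 0 := by
    intro y
    have h1 : ∀ i, inner ℂ (v i) (adjoint (A - B) y) = 0 := by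
      intro i
      rw [adjoint_inner_right, sub_apply, h, sub_self, inner_zero_left]
    have h2 : (A - B) (adjoint (A - B) y) = 0 := by
      rw [sub_apply, hA _ h1, hB _ h1, sub_self]
    rw [← inner_self_eq_zero (𝕜 := ℂ), adjoint_inner_left, h2, inner_zero_right]
  rw [← sub_eq_zero]
  ext x
  refine ext_inner_right ℂ fun y => ?_
  rw [← adjoint_inner_right, key, inner_zero_right, zero_apply, inner_zero_left]

theorem gram_exists {I : Type*} (v : I → E) (w : I → F)
    (hG : ∀ i j, inner ℂ (v i) (v j) = inner ℂ (w i) (w j)) :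
    ∃ g : E →L[ℂ] F, (∀ i, g (v i) = w i) ∧ ∀ x, (∀ i, inner ℂ (v i) x = 0) → g x = 0 := by
  classical
  let e : (I →₀ ℂ) →ₗ[ℂ] E := Finsupp.linearCombination ℂ v
  let f : (I →₀ ℂ) →ₗ[ℂ] F := Finsupp.linearCombination ℂ w
  have hinner : ∀ x y, inner ℂ (e x) (e y) = inner ℂ (f x) (f y) := by
    intro x y
    simp only [e, f, Finsupp.linearCombination_apply, Finsupp.sum, sum_inner, inner_sum,
      inner_smul_left, inner_smul_right, hG]
  have hn : ∀ x, ‖f x‖ = ‖e x‖ := by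
    intro x
    have := hinner x x
    rw [inner_self_eq_norm_sq_to_K, inner_self_eq_norm_sq_to_K] at this
    have h3 : ‖e x‖ ^ 2 = ‖f x‖ ^ 2 := by exact_mod_cast this
    exact ((sq_eq_sq₀ (norm_nonneg _) (norm_nonneg _)).1 h3).symm
  let R : Submodule ℂ E := LinearMap.range e
  let C : Submodule ℂ E := R.topologicalClosure
  let e0 : (I →₀ ℂ) →ₗ[ℂ] C :=
    Submodule.inclusion R.le_topologicalClosure ∘ₗ e.rangeRestrict
  have hd : DenseRange e0 := by
    have h1 : DenseRange (Submodule.inclusion R.le_topologicalClosure : R → C) := by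
      have := (denseRange_inclusion_iff (s := (R : Set E)) (t := (C : Set E))
        R.le_topologicalClosure).2 (by exact subset_of_eq (Submodule.topologicalClosure_coe R))
      exact this
    have h2 : Function.Surjective e.rangeRestrict := e.surjective_rangeRestrict
    exact h1.comp h2.denseRange (by
      exact continuous_inclusion (s := (R : Set E)) (t := (C : Set E)) R.le_topologicalClosure)
  have : CompleteSpace C := R.isClosed_topologicalClosure.completeSpace_coe
  have hb : ∃ D : ℝ, ∀ x, ‖f x‖ ≤ D * ‖e0 x‖ := ⟨1, fun x => by
    rw [one_mul, hn]; exact le_rfl⟩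
  refine ⟨f.extendOfNorm e0 ∘L C.orthogonalProjectionOnto, fun i => ?_, fun x hx => ?_⟩
  · have hv : e (Finsupp.single i 1) = v i := by simp [e]
    have hw : f (Finsupp.single i 1) = w i := by simp [f]
    have h1 : C.orthogonalProjectionOnto (v i) = e0 (Finsupp.single i 1) := by
      rw [← hv]
      exact C.orthogonalProjectionOnto_mem_subspace_eq_self (e0 (Finsupp.single i 1))
    rw [comp_apply, h1, LinearMap.extendOfNorm_eq hd hb, hw]
  · have : C.orthogonalProjectionOnto x = 0 := by
      rw [Submodule.orthogonalProjectionOnto_eq_zero_iff, Submodule.orthogonal_closure,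
        Submodule.mem_orthogonal]
      rintro _ ⟨c, rfl⟩
      simp only [e, Finsupp.linearCombination_apply, Finsupp.sum, sum_inner,
        inner_smul_left, hx, mul_zero, Finset.sum_const_zero]
    rw [comp_apply, this, map_zero]

/-- `g` is the partial isometry determined by `v i ↦ w i`. -/
structure GramMap {I : Type*} (v : I → E) (w : I → F) (g : E →L[ℂ] F) : Prop where
  map : ∀ i, g (v i) = w i
  adj : ∀ i, adjoint g (w i) = v i
  orth : ∀ x, (∀ i, inner ℂ (v i) x = 0) → g x = 0
  adj_orth : ∀ x, (∀ i, inner ℂ (w i) x = 0) → adjoint g x = 0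

theorem gram_exists' {I : Type*} (v : I → E) (w : I → F)
    (hG : ∀ i j, inner ℂ (v i) (v j) = inner ℂ (w i) (w j)) :
    ∃ g : E →L[ℂ] F, GramMap v w g := by
  obtain ⟨g, h1, h2⟩ := gram_exists v w hG
  refine ⟨g, h1, fun i => ?_, h2, fun y hy => ?_⟩
  · have : innerSL ℂ (w i) ∘L g = innerSL ℂ (v i) := by
      refine orth_ext v (fun j => ?_) (fun x hx => ?_) (fun x hx => ?_)
      · simp [h1, hG]
      · simp [h2 x hx]
      · simp [hx]
    refine ext_inner_right ℂ fun x => ?_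
    rw [adjoint_inner_left]
    exact congrArg (fun A : E →L[ℂ] ℂ => A x) this
  · have : innerSL ℂ y ∘L g = 0 := by
      refine orth_ext v (fun j => ?_) (fun x hx => ?_) (fun x hx => ?_)
      · simp only [comp_apply, h1, innerSL_apply_apply, zero_apply]
        rw [← inner_conj_symm, hy, map_zero]
      · simp [h2 x hx]
      · simp
    refine ext_inner_right ℂ fun x => ?_
    rw [adjoint_inner_left, inner_zero_left]
    exact congrArg (fun A : E →L[ℂ] ℂ => A x) this

theorem GramMap.ggg {I : Type*} {v : I → E} {w : I → F} {g : E →L[ℂ] F} (h : GramMap v w g)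
    (x : E) : g (adjoint g (g x)) = g x := by
  have : g ∘L adjoint g ∘L g = g := by
    refine orth_ext v (fun j => ?_) (fun x hx => ?_) h.orth
    · simp [h.map, h.adj]
    · simp [h.orth x hx]
  exact congrArg (fun A : E →L[ℂ] F => A x) this

theorem GramMap.comm {I : Type*} {v w : I → E} {g : E →L[ℂ] E} (h : GramMap v w g)
    (x : E →L[ℂ] E) (hx : ∀ i, ∃ j, x (v i) = v j ∧ x (w i) = w j)
    (hx' : ∀ i, ∃ j, adjoint x (v i) = v j) (y : E) : g (x y) = x (g y) := by
  have : g ∘L x = x ∘L g := by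
    refine orth_ext v (fun j => ?_) (fun y hy => ?_) fun y hy => ?_
    · obtain ⟨k, h1, h2⟩ := hx j
      rw [comp_apply, comp_apply, h1, h.map, h.map, h2]
    · rw [comp_apply]
      refine h.orth _ fun i => ?_
      obtain ⟨j, hj⟩ := hx' i
      rw [← adjoint_inner_left, hj, hy]
    · rw [comp_apply, h.orth y hy, map_zero]
  exact congrArg (fun A : E →L[ℂ] E => A y) this

end Gram

section StepB

variable {P : Type*} [Monoid P] {H : Type u} {K : Type*} [NormedAddCommGroup H] [InnerProductSpace ℂ H]
  [CompleteSpace H] [NormedAddCommGroup K] [InnerProductSpace ℂ K] [CompleteSpace K]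

theorem preg_of_reg {M : Type*} [Monoid M] (T : M →* (H →L[ℂ] H))
    (h : HasStarRegularDilation (fun x => T x)) :
    ∃ (K : Type u) (_ : NormedAddCommGroup K) (_ : InnerProductSpace ℂ K) (_ : CompleteSpace K)
      (ι : H →ₗᵢ[ℂ] K) (V : M →* (K →L[ℂ] K)), PReg T ι V := by
  obtain ⟨K, i1, i2, i3, ι, V, h1, hm, hiso, hreg⟩ := h
  let V' : M →* (K →L[ℂ] K) := { toFun := V, map_one' := h1, map_mul' := hm }
  have key : ∀ p q h k, inner ℂ (V p (ι h)) (V q (ι k)) =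
      inner ℂ h ((adjoint ι.toContinuousLinearMap ∘L
          ((adjoint (V p) * V q) ∘L ι.toContinuousLinearMap)) k) := by
    intro p q h k
    rw [comp_apply, adjoint_inner_right]
    change _ = inner ℂ (ι h) (adjoint (V p) (V q (ι k)))
    rw [adjoint_inner_right]
  refine ⟨K, i1, i2, i3, ι, V', ⟨fun p x => ?_, fun p q hd h k => ?_,
    fun p q r a b hl h k => ?_⟩⟩
  · exact congrArg (fun A : K →L[ℂ] K => A x) (hiso p)
  · change inner ℂ (V p (ι h)) (V q (ι k)) = 0
    rw [key, (hreg p q).1 hd, zero_apply, inner_zero_right]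
  · change inner ℂ (V p (ι h)) (V q (ι k)) = _
    rw [key, (hreg p q).2 r a b hl.1 hl.2.1 hl.2.2]
    rfl

theorem PReg.inr {T : P →* (H →L[ℂ] H)} {S : H →L[ℂ] H} {ι : H →ₗᵢ[ℂ] K}
    {V : Monoid.Coprod (Multiplicative ℕ) P →* (K →L[ℂ] K)} (h : PReg (repM T S) ι V) :
    PReg T ι (V.comp Monoid.Coprod.inr) := by
  refine ⟨fun p x => h.iso _ x, fun p q hd x y => h.disj _ _ (inr_disj hd) x y,
    fun p q r a b hl x y => ?_⟩
  have := h.lcm _ _ _ _ _ (inr_lcm hl) x y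
  rw [repM_inr, repM_inr] at this
  exact this

end StepB

set_option linter.unusedSectionVars false
section StepB2

theorem bessel_gen {P : Type*} {H K : Type*} [NormedAddCommGroup H] [InnerProductSpace ℂ H]
    [CompleteSpace H] [NormedAddCommGroup K] [InnerProductSpace ℂ K] [CompleteSpace K]
    (Z : P → H →L[ℂ] K) (h1 : ∀ p x, adjoint (Z p) (Z p x) = x)
    (h2 : ∀ p q, p ≠ q → ∀ x, adjoint (Z p) (Z q x) = 0) (F : Finset P) (y : K) :
    ∑ p ∈ F, ‖adjoint (Z p) y‖ ^ 2 ≤ ‖y‖ ^ 2 := by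
  classical
  let u : K := ∑ p ∈ F, Z p (adjoint (Z p) y)
  have hu : ∀ p ∈ F, adjoint (Z p) u = adjoint (Z p) y := by
    intro p hp
    simp only [u, map_sum]
    rw [Finset.sum_eq_single p]
    · exact h1 _ _
    · intro q _ hq
      exact h2 p q (Ne.symm hq) _
    · exact fun h => absurd hp h
  have huy : inner ℂ u y = ((∑ p ∈ F, ‖adjoint (Z p) y‖ ^ 2 : ℝ) : ℂ) := by
    simp only [u, sum_inner]
    rw [Complex.ofReal_sum]
    refine Finset.sum_congr rfl fun p _ => ?_
    rw [← adjoint_inner_right, inner_self_eq_norm_sq_to_K]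
    norm_cast
  have huu : inner ℂ u u = ((∑ p ∈ F, ‖adjoint (Z p) y‖ ^ 2 : ℝ) : ℂ) := by
    conv_lhs => enter [2]; simp only [u]
    simp only [sum_inner]
    rw [Complex.ofReal_sum]
    refine Finset.sum_congr rfl fun p hp => ?_
    rw [← adjoint_inner_right, hu p hp, inner_self_eq_norm_sq_to_K]
    norm_cast
  have e1 : ‖u‖ ^ 2 = ∑ p ∈ F, ‖adjoint (Z p) y‖ ^ 2 := by
    rw [← inner_self_eq_norm_sq (𝕜 := ℂ) u, huu]
    exact Complex.ofReal_re _
  have e2 : ∑ p ∈ F, ‖adjoint (Z p) y‖ ^ 2 ≤ ‖u‖ * ‖y‖ := by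
    have h3 : ‖inner ℂ u y‖ ≤ ‖u‖ * ‖y‖ := norm_inner_le_norm u y
    rw [huy] at h3
    refine le_trans (le_trans (le_abs_self _) ?_) h3
    rw [Complex.norm_real, Real.norm_eq_abs]
  rw [← e1] at e2 ⊢
  have : ‖u‖ ≤ ‖y‖ := by
    by_contra hlt
    push Not at hlt
    have h0 : 0 < ‖u‖ := lt_of_le_of_lt (norm_nonneg _) hlt
    nlinarith
  exact pow_le_pow_left₀ (norm_nonneg _) this 2

variable {P : Type*} [Monoid P] {H K L : Type*} [NormedAddCommGroup H] [InnerProductSpace ℂ H]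
  [CompleteSpace H] [NormedAddCommGroup K] [InnerProductSpace ℂ K] [CompleteSpace K]
  [NormedAddCommGroup L] [InnerProductSpace ℂ L] [CompleteSpace L]

theorem stepB (hP : IsRightLCMMonoid P) {T : P →* (H →L[ℂ] H)} {S : H →L[ℂ] H}
    {ι₀ : H →ₗᵢ[ℂ] L} {W : P →* (L →L[ℂ] L)} (h0 : PReg T ι₀ W) (ht : TotalVec ι₀ W)
    {ι : H →ₗᵢ[ℂ] K} {V : Monoid.Coprod (Multiplicative ℕ) P →* (K →L[ℂ] K)}
    (hV : PReg (repM T S) ι V) :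
    ∃ Q : L →L[ℂ] L, Coext ι₀ Q S ∧ (∀ x, Kill W (Q x)) ∧
      ∀ l (F : Finset P), ∑ p ∈ F, ‖adjoint Q (adjoint (W p) l)‖ ^ 2 ≤ ‖l‖ ^ 2 := by
  have hV' := hV.inr
  obtain ⟨J, hJ⟩ := gram_exists' (I := P × H) (fun i => W i.1 (ι₀ i.2))
    (fun i => V (Monoid.Coprod.inr i.1) (ι i.2)) (by
      rintro ⟨p, h⟩ ⟨q, k⟩
      rcases lcm_cases hP p q with hd | ⟨r, a, b, hl⟩
      · rw [h0.disj _ _ hd]; exact (hV'.disj _ _ hd _ _).symm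
      · rw [h0.lcm _ _ _ _ _ hl]; exact (hV'.lcm _ _ _ _ _ hl _ _).symm)
  have hJv : ∀ p h, J (W p (ι₀ h)) = V (Monoid.Coprod.inr p) (ι h) := fun p h => hJ.map (p, h)
  have hJJ : ∀ x, adjoint J (J x) = x := by
    refine ht.op (A := adjoint J ∘L J) (B := ContinuousLinearMap.id ℂ L) fun p h => ?_
    rw [comp_apply, hJv]
    exact hJ.adj (p, h)
  have hJn : ∀ x, ‖J x‖ = ‖x‖ := by
    intro x
    have : inner ℂ (J x) (J x) = inner ℂ x x := by rw [← adjoint_inner_right, hJJ]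
    rw [inner_self_eq_norm_sq_to_K, inner_self_eq_norm_sq_to_K] at this
    have h3 : ‖J x‖ ^ 2 = ‖x‖ ^ 2 := by exact_mod_cast this
    exact (sq_eq_sq₀ (norm_nonneg _) (norm_nonneg _)).1 h3
  let Z : P → H →L[ℂ] K := fun p => V (Monoid.Coprod.inr p * genE) ∘L ι.toContinuousLinearMap
  let X : P → L →L[ℂ] H := fun p => adjoint (Z p) ∘L J
  have hX : ∀ p q h k, inner ℂ k (X p (W q (ι₀ h))) =
      inner ℂ (V (Monoid.Coprod.inr p * genE) (ι k)) (V (Monoid.Coprod.inr q) (ι h)) := by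
    intro p q h k
    simp only [X, comp_apply]
    rw [adjoint_inner_right, hJv]
    rfl
  have hX0 : ∀ p q h, p ∉ rightSet q → X p (W q (ι₀ h)) = 0 := by
    intro p q h hp
    refine ext_inner_left ℂ fun k => ?_
    rw [hX, hV.disj _ _ (pe_q_disj hp), inner_zero_right]
  have hX1 : ∀ q s h, X (q * s) (W q (ι₀ h)) = adjoint S (adjoint (T s) h) := by
    intro q s h
    refine ext_inner_left ℂ fun k => ?_
    rw [hX, hV.lcm _ _ _ _ _ (pe_q_lcm q s), hom_one_apply, hom_adj_mul_apply, repM_inr,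
      repM_genE]
  have hX11 : ∀ h, X 1 (ι₀ h) = adjoint S h := by
    intro h
    have := hX1 1 1 h
    rwa [mul_one, hom_one_apply, adj_one_apply] at this
  have hXn : ∀ p, ¬ IsUnit p → ∀ x, X 1 (W p x) = 0 := by
    intro p hp
    refine ht.op (A := X 1 ∘L W p) (B := 0) fun q h => ?_
    rw [comp_apply, ← hom_mul_apply, zero_apply]
    refine hX0 _ _ _ ?_
    rintro ⟨t, htt⟩
    simp only at htt
    rw [mul_assoc] at htt
    exact hp (isUnit_of_mul_eq_one_lc hP htt)
  have hXp : ∀ p x, X p x = X 1 (adjoint (W p) x) := by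
    intro p
    refine ht.op (A := X p) (B := X 1 ∘L adjoint (W p)) fun q h => ?_
    change X p (W q (ι₀ h)) = X 1 (adjoint (W p) (W q (ι₀ h)))
    by_cases hp : p ∈ rightSet q
    · obtain ⟨s, rfl⟩ := hp
      simp only
      rw [hX1, hom_adj_mul_apply, h0.iso, h0.coext hP ht, hX11]
    · rw [hX0 p q h hp]
      rcases lcm_cases hP p q with hd | ⟨r, a, b, hl⟩
      · rw [h0.disj_apply ht hd, map_zero]
      · rw [h0.lcm_apply hP ht hl, hXn]
        rintro ⟨u, rfl⟩
        apply hp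
        refine ⟨b * ↑u⁻¹, ?_⟩
        simp only
        rw [← mul_assoc, ← hl.2.2, hl.2.1, mul_assoc, Units.mul_inv, mul_one]
  have hQ : adjoint (adjoint (ι₀.toContinuousLinearMap ∘L X 1)) = ι₀.toContinuousLinearMap ∘L X 1 :=
    adjoint_adjoint _
  refine ⟨adjoint (ι₀.toContinuousLinearMap ∘L X 1), fun h => ?_, fun x p hp => ?_,
    fun l F => ?_⟩
  · rw [hQ, comp_apply, hX11]; rfl
  · refine ext_inner_right ℂ fun y => ?_
    rw [adjoint_inner_left, adjoint_inner_left, comp_apply, hXn p hp, map_zero,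
      inner_zero_right, inner_zero_left]
  · rw [hQ]
    have e1 : ∀ p, ‖(ι₀.toContinuousLinearMap ∘L X 1) (adjoint (W p) l)‖ = ‖adjoint (Z p) (J l)‖ := by
      intro p
      rw [comp_apply, ← hXp]
      exact ι₀.norm_map _
    simp only [e1]
    rw [← hJn l]
    refine bessel_gen Z (fun p x => ?_) (fun p q hpq x => ?_) F (J l)
    · refine ext_inner_left ℂ fun y => ?_
      rw [adjoint_inner_right]
      change inner ℂ (V _ (ι y)) (V _ (ι x)) = _
      rw [← adjoint_inner_right, hV.iso, ι.inner_map_map]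
    · refine ext_inner_left ℂ fun y => ?_
      rw [adjoint_inner_right, inner_zero_right]
      exact hV.disj _ _ (pe_qe_disj hpq) _ _

theorem stepB_comm {T : P →* (H →L[ℂ] H)} {S₁ S₂ : H →L[ℂ] H} (hS : S₁ * S₂ = S₂ * S₁)
    {ι₀ : H →ₗᵢ[ℂ] L} {W : P →* (L →L[ℂ] L)} (hW : NicaRep W) (hT : ∀ p, Coext ι₀ (W p) (T p))
    (ht : TotalVec ι₀ W) {Q₁ Q₂ : L →L[ℂ] L} (c1 : Coext ι₀ Q₁ S₁) (c2 : Coext ι₀ Q₂ S₂)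
    (k1 : ∀ x, Kill W (Q₁ x)) (k2 : ∀ x, Kill W (Q₂ x)) (x : L) : Q₁ (Q₂ x) = Q₂ (Q₁ x) := by
  have hk : ∀ Q : L →L[ℂ] L, (∀ x, Kill W (Q x)) → ∀ p, ¬ IsUnit p → ∀ x, adjoint Q (W p x) = 0 := by
    intro Q k p hp x
    refine ext_inner_left ℂ fun y => ?_
    rw [adjoint_inner_right, ← adjoint_inner_left, k y p hp, inner_zero_left, inner_zero_right]
  have hS' : ∀ h, adjoint S₁ (adjoint S₂ h) = adjoint S₂ (adjoint S₁ h) := by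
    intro h
    have := congrArg (fun A => adjoint A h) hS
    simp only [mul_def, adjoint_comp] at this
    exact this.symm
  have main : ∀ x, adjoint Q₁ (adjoint Q₂ x) = adjoint Q₂ (adjoint Q₁ x) := by
    refine ht.op (A := adjoint Q₁ ∘L adjoint Q₂) (B := adjoint Q₂ ∘L adjoint Q₁) fun p h => ?_
    rw [comp_apply, comp_apply]
    by_cases hp : IsUnit p
    · obtain ⟨u, rfl⟩ := hp
      rw [hW.adj_unit, hT, c2, c1, c1, c2, hS']
    · rw [hk Q₁ k1 p hp, hk Q₂ k2 p hp, map_zero, map_zero]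
  refine ext_inner_right ℂ fun y => ?_
  rw [← adjoint_inner_right, ← adjoint_inner_right, ← adjoint_inner_right, ← adjoint_inner_right,
    main]

end StepB2

set_option linter.unusedSectionVars false
/-! ## The Fock space -/

section Fock

variable {E : Type*} [NormedAddCommGroup E] [InnerProductSpace ℂ E] [CompleteSpace E]

/-- Square summable families. -/
abbrev Fk (I : Type*) (E : Type*) [NormedAddCommGroup E] : Type _ := lp (fun _ : I => E) 2

theorem two_pos' : 0 < (2 : ENNReal).toReal := by norm_num

variable {I J : Type*}

theorem ext_not {φ : I → J} {f : I → E} {j : J} (h : j ∉ Set.range φ) :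
    Function.extend φ f 0 j = 0 := by
  rw [Function.extend_apply' _ _ _ (by simpa using h)]; rfl

theorem ext_add {φ : I → J} (hφ : Function.Injective φ) (f g : I → E) (j : J) :
    Function.extend φ (fun i => f i + g i) 0 j =
      Function.extend φ f 0 j + Function.extend φ g 0 j := by
  by_cases hj : j ∈ Set.range φ
  · obtain ⟨i, rfl⟩ := hj
    simp only [hφ.extend_apply]
  · simp only [ext_not hj, add_zero]

theorem ext_smul {φ : I → J} (hφ : Function.Injective φ) (c : ℂ) (f : I → E) (j : J) :
    Function.extend φ (fun i => c • f i) 0 j = c • Function.extend φ f 0 j := by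
  by_cases hj : j ∈ Set.range φ
  · obtain ⟨i, rfl⟩ := hj
    simp only [hφ.extend_apply]
  · simp only [ext_not hj, smul_zero]

theorem mem_push (φ : I → J) (hφ : Function.Injective φ) (f : Fk I E) :
    Memℓp (E := fun _ : J => E) (Function.extend φ f 0) 2 := by
  rw [memℓp_gen_iff two_pos']
  have h : Summable fun i => ‖f i‖ ^ (2 : ENNReal).toReal := (memℓp_gen_iff two_pos').1 f.2
  rw [← hφ.summable_iff]
  · convert h using 2 with i
    simp only [Function.comp, hφ.extend_apply]
  · intro j hj
    rw [ext_not hj]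
    simp

/-- Push forward along an injection. -/
noncomputable def push (φ : I → J) (hφ : Function.Injective φ) : Fk I E →ₗᵢ[ℂ] Fk J E :=
  LinearMap.isometryOfInner
    { toFun := fun f => (⟨Function.extend φ f 0, mem_push φ hφ f⟩ : lp (fun _ : J => E) 2)
      map_add' := by
        intro f g
        ext j
        exact ext_add hφ f g j
      map_smul' := by
        intro c f
        ext j
        exact ext_smul hφ c f j }
    (by
      intro f g
      rw [lp.inner_eq_tsum, lp.inner_eq_tsum]
      change ∑' j, inner ℂ (Function.extend φ f 0 j) (Function.extend φ g 0 j) = _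
      rw [← hφ.tsum_eq]
      · simp only [hφ.extend_apply]
      · intro j hj
        by_contra h
        apply hj
        change inner ℂ (Function.extend φ (fun i => f i) 0 j) _ = 0
        rw [ext_not (E := E) h, inner_zero_left])

theorem push_apply (φ : I → J) (hφ : Function.Injective φ) (f : Fk I E) (i : I) :
    push φ hφ f (φ i) = f i := hφ.extend_apply f 0 i

theorem push_not (φ : I → J) (hφ : Function.Injective φ) (f : Fk I E) {j : J}
    (h : j ∉ Set.range φ) : push φ hφ f j = 0 := ext_not h

theorem adj_push (φ : I → J) (hφ : Function.Injective φ) (f : Fk J E) (i : I) :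
    adjoint (push φ hφ).toContinuousLinearMap f i = f (φ i) := by
  classical
  refine ext_inner_left ℂ fun a => ?_
  rw [← lp.inner_single_left (G := fun _ : I => E) (𝕜 := ℂ), adjoint_inner_right]
  have : (push φ hφ).toContinuousLinearMap (lp.single 2 i a) =
      (lp.single 2 (φ i) a : lp (fun _ : J => E) 2) := by
    ext j
    change push φ hφ (lp.single 2 i a) j = _
    by_cases hj : j ∈ Set.range φ
    · obtain ⟨k, rfl⟩ := hj
      rw [push_apply]
      by_cases hk : k = i
      · subst hk; rw [lp.single_apply_self, lp.single_apply_self]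
      · rw [lp.single_apply_ne (E := fun _ : I => E) _ _ _ hk,
          lp.single_apply_ne (E := fun _ : J => E) _ _ _ (fun h => hk (hφ h))]
    · rw [push_not _ _ _ hj, lp.single_apply_ne (E := fun _ : J => E)]
      rintro rfl
      exact hj ⟨i, rfl⟩
  rw [this, lp.inner_single_left (G := fun _ : J => E)]

open Classical in
/-- Embedding of a single coordinate. -/
noncomputable def sing (i : I) : E →L[ℂ] Fk I E :=
  LinearMap.mkContinuous (lp.lsingle (E := fun _ : I => E) (𝕜 := ℂ) 2 i) 1 (fun x => by
    rw [one_mul]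
    exact le_of_eq (lp.norm_single (E := fun _ : I => E) (by norm_num) i x))

theorem sing_self (i : I) (x : E) : sing i x i = x := by
  classical
  exact Pi.single_eq_same (M := fun _ : I => E) i x

theorem sing_ne (i : I) (x : E) {j : I} (h : j ≠ i) : sing i x j = 0 := by
  classical
  exact Pi.single_eq_of_ne (M := fun _ : I => E) h x

theorem adj_sing (i : I) (f : Fk I E) : adjoint (sing i) f = f i := by
  classical
  refine ext_inner_left ℂ fun a => ?_
  rw [adjoint_inner_right]
  have : sing i a = (lp.single 2 i a : lp (fun _ : I => E) 2) := by
    ext j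
    by_cases h : j = i
    · subst h; rw [sing_self, lp.single_apply_self]
    · rw [sing_ne _ _ h, lp.single_apply_ne (E := fun _ : I => E) _ _ _ h]
  rw [this, lp.inner_single_left (G := fun _ : I => E)]

/-- Column operator. -/
theorem col_exists {L : Type*} [NormedAddCommGroup L] [InnerProductSpace ℂ L]
    (C : I → L →L[ℂ] E) (hC : ∀ l (F : Finset I), ∑ i ∈ F, ‖C i l‖ ^ 2 ≤ ‖l‖ ^ 2) :
    ∃ Θ : L →L[ℂ] Fk I E, ‖Θ‖ ≤ 1 ∧ ∀ l i, Θ l i = C i l := by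
  have hC' : ∀ l (F : Finset I), ∑ i ∈ F, ‖C i l‖ ^ (2 : ENNReal).toReal ≤
      ‖l‖ ^ (2 : ENNReal).toReal := by
    intro l F
    have := hC l F
    simpa using this
  let Θ : L →ₗ[ℂ] Fk I E :=
    { toFun := fun l => (⟨fun i => C i l, memℓp_gen' (hC' l)⟩ : lp (fun _ : I => E) 2)
      map_add' := by
        intro x y; ext i; exact map_add (C i) x y
      map_smul' := by
        intro c x; ext i; exact map_smul (C i) c x }
  refine ⟨Θ.mkContinuous 1 fun l => ?_, LinearMap.mkContinuous_norm_le _ zero_le_one _,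
    fun l i => rfl⟩
  rw [one_mul]
  exact lp.norm_le_of_forall_sum_le two_pos' (norm_nonneg _) (hC' l)

end Fock

/-- The data on the Fock space needed for the construction. -/
structure FockData {P : Type*} [Monoid P] {L Y : Type*} [NormedAddCommGroup L]
    [InnerProductSpace ℂ L] [CompleteSpace L] [NormedAddCommGroup Y]
    [InnerProductSpace ℂ Y] [CompleteSpace Y] (W : P →* (Y →L[ℂ] Y)) (σ : Y →L[ℂ] Y)
    (ε : L →L[ℂ] Y) : Prop where
  nica : NicaRep W
  free : FreePair W σ
  eps : ∀ l, adjoint ε (ε l) = l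
  eps_ne : ∀ p, p ≠ 1 → ∀ l, adjoint ε (W p (ε l)) = 0
  kill : ∀ l, Kill W (ε l)
  sig_eps : ∀ p l, adjoint σ (W p (ε l)) = 0

/-- The intertwining operator on the Fock space. -/
structure ThetaData {P : Type*} [Monoid P] {L Y : Type*} [NormedAddCommGroup L]
    [InnerProductSpace ℂ L] [CompleteSpace L] [NormedAddCommGroup Y]
    [InnerProductSpace ℂ Y] [CompleteSpace Y] (W₀ : P →* (L →L[ℂ] L)) (W : P →* (Y →L[ℂ] Y))
    (σ : Y →L[ℂ] Y) (ε : L →L[ℂ] Y) (Q : L →L[ℂ] L) (Θ : L →L[ℂ] Y) : Prop where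
  norm : ‖Θ‖ ≤ 1
  adj : ∀ p l, adjoint (W p) (Θ l) = Θ (adjoint (W₀ p) l)
  comm : ∀ p l, W p (Θ l) = Θ (W₀ p l)
  eps : ∀ l, adjoint ε (Θ l) = adjoint Q l
  sig : ∀ l, adjoint σ (Θ l) = 0

section FockRep

variable {P : Type u} [Monoid P] {L : Type u} [NormedAddCommGroup L]
    [InnerProductSpace ℂ L] [CompleteSpace L]

/-- Left translation of indices. -/
def phiW (p : P) : P × List P → P × List P := fun x => (p * x.1, x.2)

/-- The shift of indices. -/
def phiS : P × List P → P × List P := fun x => (1, x.1 :: x.2)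

theorem phiS_inj : Function.Injective (phiS : P × List P → P × List P) := by
  rintro ⟨p, w⟩ ⟨q, v⟩ h
  simpa [phiS] using h

theorem phiW_inj (hP : IsRightLCMMonoid P) (p : P) : Function.Injective (phiW p) := by
  rintro ⟨q, w⟩ ⟨r, v⟩ h
  simp only [phiW, Prod.mk.injEq] at h
  rw [hP.1 _ _ _ h.1, h.2]

theorem phiW_not {p q : P} {w : List P} (h : q ∉ rightSet p) : (q, w) ∉ Set.range (phiW p) := by
  rintro ⟨⟨r, v⟩, hh⟩
  simp only [phiW, Prod.mk.injEq] at hh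
  exact h ⟨r, hh.1⟩

/-- Translation representation on Fock space. -/
noncomputable def fW (hP : IsRightLCMMonoid P) : P →* (Fk (P × List P) L →L[ℂ] Fk (P × List P) L) where
  toFun p := (push (phiW p) (phiW_inj hP p)).toContinuousLinearMap
  map_one' := by
    ext f ⟨q, w⟩
    have := push_apply (phiW 1) (phiW_inj hP 1) f (q, w)
    simp only [phiW, one_mul] at this
    exact this
  map_mul' := by
    intro p r
    ext f ⟨q, w⟩
    change push (phiW (p * r)) (phiW_inj hP _) f (q, w) =
      push (phiW p) (phiW_inj hP _) (push (phiW r) (phiW_inj hP _) f) (q, w)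
    by_cases hq : q ∈ rightSet p
    · obtain ⟨t, rfl⟩ := hq
      rw [show ((fun x => p * x) t, w) = phiW p (t, w) from rfl, push_apply]
      by_cases ht : t ∈ rightSet r
      · obtain ⟨s, rfl⟩ := ht
        rw [show phiW p ((fun x => r * x) s, w) = phiW (p * r) (s, w) by simp [phiW, mul_assoc],
          push_apply, show ((fun x => r * x) s, w) = phiW r (s, w) from rfl, push_apply]
      · rw [push_not (phiW r) _ _ (phiW_not ht)]
        refine push_not _ _ _ (phiW_not ?_)
        rintro ⟨s, hs⟩
        simp only [mul_assoc] at hs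
        exact ht ⟨s, hP.1 _ _ _ hs⟩
    · rw [push_not (phiW p) _ _ (phiW_not hq)]
      refine push_not _ _ _ (phiW_not ?_)
      rintro ⟨s, hs⟩
      exact hq ⟨r * s, by simpa [mul_assoc] using hs⟩

theorem fW_mul (hP : IsRightLCMMonoid P) (p q : P) (w : List P) (f : Fk (P × List P) L) :
    fW hP p f (p * q, w) = f (q, w) := push_apply (phiW p) (phiW_inj hP p) f (q, w)

theorem fW_not (hP : IsRightLCMMonoid P) {p q : P} (h : q ∉ rightSet p) (w : List P)
    (f : Fk (P × List P) L) : fW hP p f (q, w) = 0 :=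
  push_not (phiW p) (phiW_inj hP p) f (phiW_not h)

theorem fW_adj (hP : IsRightLCMMonoid P) (p q : P) (w : List P)
    (f : Fk (P × List P) L) : adjoint (fW hP p) f (q, w) = f (p * q, w) :=
  adj_push (phiW p) (phiW_inj hP p) f (q, w)

/-- Shift on Fock space. -/
noncomputable def fS : Fk (P × List P) L →L[ℂ] Fk (P × List P) L :=
  (push phiS phiS_inj).toContinuousLinearMap

theorem fS_cons (q : P) (w : List P) (f : Fk (P × List P) L) : fS f (1, q :: w) = f (q, w) :=
  push_apply phiS phiS_inj f (q, w)

theorem fS_not {q : P} (h : q ≠ 1) (w : List P) (f : Fk (P × List P) L) : fS f (q, w) = 0 := by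
  refine push_not phiS phiS_inj f ?_
  rintro ⟨⟨r, v⟩, hh⟩
  simp only [phiS, Prod.mk.injEq] at hh
  exact h hh.1.symm

theorem fS_adj (q : P) (w : List P) (f : Fk (P × List P) L) :
    adjoint fS f (q, w) = f (1, q :: w) :=
  adj_push phiS phiS_inj f (q, w)

theorem fockData (hP : IsRightLCMMonoid P) :
    FockData (fW hP) (fS : Fk (P × List P) L →L[ℂ] _) (sing (1, [])) := by
  have hnu : ∀ {p : P}, ¬ IsUnit p → (1 : P) ∉ rightSet p := by
    rintro p hp ⟨t, ht⟩
    exact hp (isUnit_of_mul_eq_one_lc hP ht)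
  refine ⟨⟨fun p x => ?_, fun p q hd x => ?_, fun p q r a b hl x => ?_⟩,
    ⟨fun x => ?_, fun p hp x => ?_, fun p hp x => ?_⟩, fun l => ?_, fun p hp l => ?_,
    fun l p hp => ?_, fun p l => ?_⟩
  · ext ⟨q, w⟩
    rw [fW_adj, fW_mul]
  · ext ⟨s, w⟩
    rw [fW_adj, fW_not]
    · rfl
    · intro h
      have : p * s ∈ rightSet p ∩ rightSet q := ⟨⟨s, rfl⟩, h⟩
      rw [hd] at this
      exact this
  · ext ⟨s, w⟩
    rw [fW_adj]
    by_cases hs : s ∈ rightSet a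
    · obtain ⟨t, rfl⟩ := hs
      simp only
      rw [fW_mul, fW_adj, ← mul_assoc, ← hl.2.1, hl.2.2, mul_assoc, fW_mul]
    · rw [fW_not hP hs, fW_not]
      intro h
      have : p * s ∈ rightSet p ∩ rightSet q := ⟨⟨s, rfl⟩, h⟩
      rw [hl.1] at this
      obtain ⟨t, ht⟩ := this
      simp only at ht
      rw [hl.2.1, mul_assoc] at ht
      exact hs ⟨t, hP.1 _ _ _ ht⟩
  · ext ⟨q, w⟩
    rw [fS_adj, fS_cons]
  · ext ⟨q, w⟩
    rw [fS_adj, fW_not hP (hnu hp)]; rfl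
  · ext ⟨q, w⟩
    rw [fS_adj]
    by_cases h : (1 : P) ∈ rightSet p
    · obtain ⟨t, ht⟩ := h
      simp only at ht
      rw [← ht, fW_mul, fS_not]
      · rfl
      · rintro rfl; exact hp (by simpa using ht)
    · rw [fW_not hP h]; rfl
  · rw [adj_sing, sing_self]
  · rw [adj_sing]
    by_cases h : (1 : P) ∈ rightSet p
    · obtain ⟨t, ht⟩ := h
      simp only at ht
      have hh := fW_mul hP p t [] (sing (1, []) l)
      rw [ht] at hh
      rw [hh, sing_ne]
      intro h
      rw [Prod.mk.injEq] at h
      rw [h.1] at ht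
      exact hp (by simpa using ht)
    · rw [fW_not hP h]
  · ext ⟨s, w⟩
    rw [fW_adj, sing_ne]
    · rfl
    · intro h
      rw [Prod.mk.injEq] at h
      exact hnu hp ⟨s, h.1⟩
  · ext ⟨q, w⟩
    rw [fS_adj]
    by_cases h : (1 : P) ∈ rightSet p
    · obtain ⟨t, ht⟩ := h
      simp only at ht
      conv_lhs => rw [← ht]
      rw [fW_mul, sing_ne]
      · rfl
      · intro h
        rw [Prod.mk.injEq] at h
        exact List.cons_ne_nil _ _ h.2
    · rw [fW_not hP h]; rfl

theorem theta_exists (hP : IsRightLCMMonoid P) {W₀ : P →* (L →L[ℂ] L)} (hW : NicaRep W₀)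
    {Q : L →L[ℂ] L} (hk : ∀ x, Kill W₀ (Q x))
    (hB : ∀ l (F : Finset P), ∑ p ∈ F, ‖adjoint Q (adjoint (W₀ p) l)‖ ^ 2 ≤ ‖l‖ ^ 2) :
    ∃ Θ, ThetaData W₀ (fW hP) (fS : Fk (P × List P) L →L[ℂ] _) (sing (1, [])) Q Θ := by
  classical
  let C : P × List P → L →L[ℂ] L := fun x => if x.2 = [] then adjoint Q ∘L adjoint (W₀ x.1) else 0
  have hC0 : ∀ p l, C (p, []) l = adjoint Q (adjoint (W₀ p) l) := by
    intro p l
    simp [C]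
  have hC1 : ∀ p q w l, C (p, q :: w) l = 0 := by
    intro p q w l
    simp [C]
  obtain ⟨Θ, hn, hΘ⟩ := col_exists C (by
    intro l F
    refine le_trans ?_ (hB l ((F.filter fun x => x.2 = []).image Prod.fst))
    rw [Finset.sum_image]
    · rw [Finset.sum_filter]
      refine le_of_eq (Finset.sum_congr rfl fun x _ => ?_)
      by_cases hx : x.2 = []
      · simp [C, hx]
      · simp [C, hx]
    · rintro ⟨a, b⟩ ha ⟨c, d⟩ hc h
      simp only [Finset.coe_filter, Set.mem_ofPred_eq] at ha hc h
      rw [ha.2, hc.2, h])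
  refine ⟨Θ, hn, fun p l => ?_, fun p l => ?_, fun l => ?_, fun l => ?_⟩
  · ext ⟨q, w⟩
    rw [fW_adj, hΘ, hΘ]
    rcases w with _ | ⟨c, w⟩
    · rw [hC0, hC0, hom_adj_mul_apply]
    · rw [hC1, hC1]
  · ext ⟨q, w⟩
    rw [hΘ]
    by_cases hq : q ∈ rightSet p
    · obtain ⟨t, rfl⟩ := hq
      simp only
      rw [fW_mul, hΘ]
      rcases w with _ | ⟨c, w⟩
      · rw [hC0, hC0, hom_adj_mul_apply, hW.iso]
      · rw [hC1, hC1]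
    · rw [fW_not hP hq]
      rcases w with _ | ⟨c, w⟩
      · rw [hC0]
        refine ext_inner_left ℂ fun y => ?_
        rw [adjoint_inner_right, adjoint_inner_right, ← adjoint_inner_left,
          hW.kill_notMem hP (hk y) hq, inner_zero_left, inner_zero_right]
      · rw [hC1]
  · rw [adj_sing, hΘ, hC0, adj_one_apply]
  · ext ⟨q, w⟩
    rw [fS_adj, hΘ, hC1]; rfl

end FockRep

set_option linter.unusedSectionVars false
/-! ## Defect operators -/

section Defect

variable {P : Type*} [Monoid P] {L Y : Type*} [NormedAddCommGroup L]
    [InnerProductSpace ℂ L] [CompleteSpace L] [NormedAddCommGroup Y]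
    [InnerProductSpace ℂ Y] [CompleteSpace Y]

theorem sqrt_exists (Θ : L →L[ℂ] Y) (hΘ : ‖Θ‖ ≤ 1) :
    ∃ Δ : Y →L[ℂ] Y, adjoint Δ = Δ ∧ (∀ x, Δ (Δ x) = x - Θ (adjoint Θ x)) ∧
      ∀ b : Y →L[ℂ] Y, (∀ x, b (Θ (adjoint Θ x)) = Θ (adjoint Θ (b x))) →
        ∀ x, b (Δ x) = Δ (b x) := by
  let N : Y →L[ℂ] Y := 1 - Θ ∘L adjoint Θ
  have hN : 0 ≤ N := by
    rw [nonneg_iff_isPositive, isPositive_def']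
    constructor
    · rw [isSelfAdjoint_iff']
      simp [N, one_def, adjoint_comp, adjoint_adjoint, adjoint_id]
    · intro x
      have h1 : ‖adjoint Θ x‖ ≤ ‖x‖ := by
        refine le_trans (le_opNorm _ _) ?_
        have : ‖adjoint Θ‖ ≤ 1 := by rwa [LinearIsometryEquiv.norm_map]
        calc ‖adjoint Θ‖ * ‖x‖ ≤ 1 * ‖x‖ := by gcongr
          _ = ‖x‖ := one_mul _
      rw [reApplyInnerSelf_apply]
      change 0 ≤ RCLike.re (inner ℂ (x - Θ (adjoint Θ x)) x)
      rw [inner_sub_left, ← adjoint_inner_right, map_sub, inner_self_eq_norm_sq,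
        inner_self_eq_norm_sq]
      have := pow_le_pow_left₀ (norm_nonneg _) h1 2
      linarith
  refine ⟨CFC.sqrt N, ?_, fun x => ?_, fun b hb x => ?_⟩
  · have := CFC.sqrt_nonneg N
    rw [nonneg_iff_isPositive, isPositive_def'] at this
    exact isSelfAdjoint_iff'.1 this.1
  · have := congrArg (fun A : Y →L[ℂ] Y => A x) (CFC.sqrt_mul_sqrt_self N hN)
    exact this
  · have hc : Commute N b := by
      ext y
      change b y - Θ (adjoint Θ (b y)) = b (y - Θ (adjoint Θ y))
      rw [map_sub, hb]
    have : Commute (CFC.sqrt N) b := by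
      unfold CFC.sqrt
      exact hc.cfcₙ_nnreal _
    exact (congrArg (fun A : Y →L[ℂ] Y => A x) this.eq).symm

/-- Inner product description of the defect operator. -/
structure DData (W₀ : P →* (L →L[ℂ] L)) (W : P →* (Y →L[ℂ] Y)) (σ : Y →L[ℂ] Y)
    (Q : L →L[ℂ] L) (D : L →L[ℂ] Y) : Prop where
  gram1 : ∀ h k, inner ℂ (D h) (D k) = inner ℂ h k - inner ℂ (Q h) (Q k)
  gram : ∀ p, p ≠ 1 → ∀ h k, inner ℂ (D h) (W p (D k)) = - inner ℂ (Q h) (W₀ p (Q k))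
  kill : ∀ l, Kill W (D l)
  sig : ∀ p l, adjoint σ (W p (D l)) = 0

theorem ddata_exists {W₀ : P →* (L →L[ℂ] L)} {W : P →* (Y →L[ℂ] Y)} {σ : Y →L[ℂ] Y}
    {ε : L →L[ℂ] Y} {Q : L →L[ℂ] L} {Θ : L →L[ℂ] Y} (hF : FockData W σ ε)
    (hT : ThetaData W₀ W σ ε Q Θ) : ∃ D, DData W₀ W σ Q D := by
  obtain ⟨Δ, hsa, hsq, hcomm⟩ := sqrt_exists Θ hT.norm
  have hΘW : ∀ p y, adjoint Θ (W p y) = W₀ p (adjoint Θ y) := by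
    intro p y
    refine ext_inner_left ℂ fun l => ?_
    rw [adjoint_inner_right, ← adjoint_inner_left, hT.adj, ← adjoint_inner_right,
      adjoint_inner_left]
  have hΘW' : ∀ p y, adjoint Θ (adjoint (W p) y) = adjoint (W₀ p) (adjoint Θ y) := by
    intro p y
    refine ext_inner_left ℂ fun l => ?_
    rw [adjoint_inner_right, adjoint_inner_right, adjoint_inner_right, adjoint_inner_right,
      hT.comm]
  have hΘσ : ∀ y, adjoint Θ (σ y) = 0 := by
    intro y
    refine ext_inner_left ℂ fun l => ?_
    rw [adjoint_inner_right, ← adjoint_inner_left, hT.sig, inner_zero_left, inner_zero_right]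
  have hΘε : ∀ l, adjoint Θ (ε l) = Q l := by
    intro l
    refine ext_inner_left ℂ fun k => ?_
    rw [adjoint_inner_right, ← adjoint_inner_left, hT.eps, adjoint_inner_left]
  have cW : ∀ p x, W p (Δ x) = Δ (W p x) := fun p => hcomm (W p) fun x => by
    rw [hT.comm, hΘW]
  have cW' : ∀ p x, adjoint (W p) (Δ x) = Δ (adjoint (W p) x) := fun p =>
    hcomm (adjoint (W p)) fun x => by rw [hT.adj, hΘW']
  have cσ : ∀ x, σ (adjoint σ (Δ x)) = Δ (σ (adjoint σ x)) :=
    hcomm (σ ∘L adjoint σ) fun x => by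
      rw [comp_apply, comp_apply, hT.sig, hΘσ, map_zero, map_zero]
  have hΔ : ∀ x y, inner ℂ (Δ x) y = inner ℂ x (Δ y) := by
    intro x y
    conv_lhs => rw [← hsa]
    rw [adjoint_inner_left]
  have hg : ∀ p h k, inner ℂ (Δ (ε h)) (W p (Δ (ε k))) =
      inner ℂ h (adjoint ε (W p (ε k))) - inner ℂ (Q h) (W₀ p (Q k)) := by
    intro p h k
    rw [hΔ, ← cW, hsq, map_sub, inner_sub_right, ← adjoint_inner_right, hT.comm,
      ← adjoint_inner_right ε, hT.eps, adjoint_inner_right Q, hΘε]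
  refine ⟨Δ ∘L ε, fun h k => ?_, fun p hp h k => ?_, fun l p hp => ?_, fun p l => ?_⟩
  · have := hg 1 h k
    rw [hom_one_apply, hom_one_apply, hom_one_apply, hF.eps] at this
    exact this
  · have := hg p h k
    rw [hF.eps_ne p hp, inner_zero_right, zero_sub] at this
    exact this
  · rw [comp_apply, cW', hF.kill l p hp, map_zero]
  · rw [comp_apply, cW, ← hF.free.iso (adjoint σ _), cσ, hF.sig_eps, map_zero, map_zero, map_zero]

end Defect

section Relation

variable {P : Type*} [Monoid P] {L Y : Type*} [NormedAddCommGroup L]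
    [InnerProductSpace ℂ L] [CompleteSpace L] [NormedAddCommGroup Y]
    [InnerProductSpace ℂ Y] [CompleteSpace Y]

theorem kill_gram (hP : IsRightLCMMonoid P) {W : P →* (Y →L[ℂ] Y)} (hW : NicaRep W)
    {c c' d d' : Y} (hc' : Kill W c') (hd' : Kill W d')
    (h : ∀ s, inner ℂ c (W s c') = inner ℂ d (W s d')) (hc : Kill W c) (hd : Kill W d) (p q : P) :
    inner ℂ (W p c) (W q c') = inner ℂ (W p d) (W q d') := by
  rw [← adjoint_inner_right, ← adjoint_inner_right (W p)]
  by_cases hq : q ∈ rightSet p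
  · obtain ⟨s, rfl⟩ := hq
    simp only
    rw [hW.adj_mul, hW.adj_mul, h]
  · rw [hW.kill_notMem hP hc' hq, hW.kill_notMem hP hd' hq, inner_zero_right, inner_zero_right]

theorem Kill.add {W : P →* (Y →L[ℂ] Y)} {c d : Y} (hc : Kill W c) (hd : Kill W d) :
    Kill W (c + d) := by
  intro p hp
  rw [map_add, hc p hp, hd p hp, add_zero]

theorem FreePair.inner_iso {W : P →* (Y →L[ℂ] Y)} {σ : Y →L[ℂ] Y} (h : FreePair W σ) (x y : Y) :
    inner ℂ (σ x) (σ y) = inner ℂ x y := by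
  rw [← adjoint_inner_right, h.iso]

theorem FreePair.inner_ne {W : P →* (Y →L[ℂ] Y)} {σ : Y →L[ℂ] Y} (h : FreePair W σ) {p : P}
    (hp : p ≠ 1) (x y : Y) : inner ℂ (σ x) (W p (σ y)) = 0 := by
  rw [← adjoint_inner_right, h.ne_one p hp, inner_zero_right]

variable {W₀ : P →* (L →L[ℂ] L)} {W : P →* (Y →L[ℂ] Y)} {σ : Y →L[ℂ] Y} {Q Q₁ Q₂ : L →L[ℂ] L}
  {D D₁ D₂ : L →L[ℂ] Y}

theorem DData.sig_left (hW : NicaRep W) (h : DData W₀ W σ Q D) (p : P) (l : L) (y : Y) :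
    inner ℂ (D l) (W p (σ y)) = 0 := by
  rw [← adjoint_inner_left]
  by_cases hp : IsUnit p
  · obtain ⟨u, rfl⟩ := hp
    rw [hW.unit_adj, ← adjoint_inner_left, h.sig, inner_zero_left]
  · rw [h.kill l p hp, inner_zero_left]

theorem DData.sig_right (h : DData W₀ W σ Q D) (p : P) (l : L) (y : Y) :
    inner ℂ (σ y) (W p (D l)) = 0 := by
  rw [← adjoint_inner_right, h.sig, inner_zero_right]

theorem A_gram1 (hW : NicaRep W) (hσ : FreePair W σ) (h1 : DData W₀ W σ Q₁ D₁)
    (h2 : DData W₀ W σ Q₂ D₂) (h k : L) :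
    inner ℂ (D₁ (Q₂ h) + σ (D₂ h)) (D₁ (Q₂ k) + σ (D₂ k)) =
      inner ℂ h k - inner ℂ (Q₁ (Q₂ h)) (Q₁ (Q₂ k)) := by
  have e1 := h1.sig_left hW 1 (Q₂ h) (D₂ k)
  have e2 := h1.sig_right 1 (Q₂ k) (D₂ h)
  rw [hom_one_apply] at e1 e2
  rw [inner_add_left, inner_add_right, inner_add_right, h1.gram1, e1, e2, hσ.inner_iso, h2.gram1]
  ring

theorem A_gram (hW : NicaRep W) (hσ : FreePair W σ) (h1 : DData W₀ W σ Q₁ D₁)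
    (h2 : DData W₀ W σ Q₂ D₂) {s : P} (hs : s ≠ 1) (h k : L) :
    inner ℂ (D₁ (Q₂ h) + σ (D₂ h)) (W s (D₁ (Q₂ k) + σ (D₂ k))) =
      - inner ℂ (Q₁ (Q₂ h)) (W₀ s (Q₁ (Q₂ k))) := by
  rw [map_add, inner_add_left, inner_add_right, inner_add_right, h1.gram s hs,
    h1.sig_left hW, h1.sig_right, hσ.inner_ne hs]
  ring

theorem A_tau (hW : NicaRep W) (hσ : FreePair W σ) (h1 : DData W₀ W σ Q₁ D₁)
    (h2 : DData W₀ W σ Q₂ D₂) (s : P) (h : L) (y : Y) :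
    inner ℂ (D₁ (Q₂ h) + σ (D₂ h)) (W s (σ (σ y))) = 0 := by
  rw [inner_add_left, h1.sig_left hW, zero_add]
  by_cases hs : s = 1
  · subst hs
    have := h2.sig_left hW 1 h y
    rw [hom_one_apply] at this
    rw [hom_one_apply, hσ.inner_iso, this]
  · rw [hσ.inner_ne hs]

theorem tau_A (hσ : FreePair W σ) (h1 : DData W₀ W σ Q₁ D₁)
    (h2 : DData W₀ W σ Q₂ D₂) (s : P) (h : L) :
    adjoint σ (adjoint σ (W s (D₁ (Q₂ h) + σ (D₂ h)))) = 0 := by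
  rw [map_add, map_add, h1.sig, zero_add]
  by_cases hs : s = 1
  · subst hs
    have := h2.sig 1 h
    rw [hom_one_apply] at this
    rw [hom_one_apply, hσ.iso, this]
  · rw [hσ.ne_one s hs, map_zero]

/-- The family of pairs defining the partial isometry. -/
inductive RelP (W : P →* (Y →L[ℂ] Y)) (σ : Y →L[ℂ] Y) (Q₁ Q₂ : L →L[ℂ] L) (D₁ D₂ : L →L[ℂ] Y) :
    Y → Y → Prop
  | base (p : P) (h : L) : RelP W σ Q₁ Q₂ D₁ D₂ (W p (D₁ (Q₂ h) + σ (D₂ h)))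
      (W p (D₂ (Q₁ h) + σ (D₁ h)))
  | step (p : P) (v w : Y) (hvw : RelP W σ Q₁ Q₂ D₁ D₂ v w) : RelP W σ Q₁ Q₂ D₁ D₂
      (W p (σ (σ v))) (W p (σ (σ w)))

theorem RelP.zero : RelP W σ Q₁ Q₂ D₁ D₂ 0 0 := by
  have := RelP.base (W := W) (σ := σ) (Q₁ := Q₁) (Q₂ := Q₂) (D₁ := D₁) (D₂ := D₂) 1 0
  simpa using this

theorem A_kill (hσ : FreePair W σ) (h1 : DData W₀ W σ Q₁ D₁) (h : L) :
    Kill W (D₁ (Q₂ h) + σ (D₂ h)) := (h1.kill _).add (hσ.kill _)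

theorem RelP.gram (hP : IsRightLCMMonoid P) (hW : NicaRep W) (hσ : FreePair W σ)
    (h1 : DData W₀ W σ Q₁ D₁) (h2 : DData W₀ W σ Q₂ D₂) (hQ : ∀ x, Q₁ (Q₂ x) = Q₂ (Q₁ x))
    {v w : Y} (hvw : RelP W σ Q₁ Q₂ D₁ D₂ v w) : ∀ {v' w' : Y},
    RelP W σ Q₁ Q₂ D₁ D₂ v' w' → inner ℂ v v' = inner ℂ w w' := by
  have bs : ∀ p q h y z, inner ℂ (W p (D₁ (Q₂ h) + σ (D₂ h))) (W q (σ (σ y))) =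
      inner ℂ (W p (D₂ (Q₁ h) + σ (D₁ h))) (W q (σ (σ z))) := by
    intro p q h y z
    refine kill_gram hP hW (hσ.kill _) (hσ.kill _) (fun s => ?_) (A_kill hσ h1 h) (A_kill hσ h2 h)
      p q
    rw [A_tau hW hσ h1 h2, A_tau hW hσ h2 h1]
  induction hvw with
  | base p h =>
    intro v' w' h'
    cases h' with
    | base q k =>
      refine kill_gram hP hW (A_kill hσ h1 k) (A_kill hσ h2 k) (fun s => ?_) (A_kill hσ h1 h)
        (A_kill hσ h2 h) p q
      by_cases hs : s = 1
      · subst hs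
        rw [hom_one_apply, hom_one_apply, A_gram1 hW hσ h1 h2, A_gram1 hW hσ h2 h1, hQ, hQ]
      · rw [A_gram hW hσ h1 h2 hs, A_gram hW hσ h2 h1 hs, hQ, hQ]
    | step q v w _ => exact bs p q h v w
  | step p v w _ ih =>
    intro v' w' h'
    cases h' with
    | base q k =>
      rw [← inner_conj_symm, bs q p k v w, inner_conj_symm]
    | step q v' w' hr =>
      refine kill_gram hP hW (hσ.kill _) (hσ.kill _) (fun s => ?_) (hσ.kill _)
        (hσ.kill _) p q
      by_cases hs : s = 1
      · subst hs
        rw [hom_one_apply, hom_one_apply, hσ.inner_iso, hσ.inner_iso, hσ.inner_iso, hσ.inner_iso,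
          ih hr]
      · rw [hσ.inner_ne hs, hσ.inner_ne hs]

theorem RelP.mapW {v w : Y} (hr : RelP W σ Q₁ Q₂ D₁ D₂ v w) (q : P) :
    RelP W σ Q₁ Q₂ D₁ D₂ (W q v) (W q w) := by
  cases hr with
  | base p h => rw [← hom_mul_apply, ← hom_mul_apply]; exact .base _ _
  | step p v w hr => rw [← hom_mul_apply, ← hom_mul_apply]; exact .step _ _ _ hr

theorem kill_adj (hP : IsRightLCMMonoid P) (hW : NicaRep W) {c d : Y} (hc : Kill W c)
    (hd : Kill W d) (R : Y → Y → Prop) (h0 : R 0 0) (hR : ∀ s, R (W s c) (W s d)) (p q : P) :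
    R (adjoint (W q) (W p c)) (adjoint (W q) (W p d)) := by
  by_cases hq : p ∈ rightSet q
  · obtain ⟨s, rfl⟩ := hq
    simp only
    rw [hW.adj_mul, hW.adj_mul]
    exact hR s
  · rwa [hW.kill_notMem hP hc hq, hW.kill_notMem hP hd hq]

theorem RelP.adjW (hP : IsRightLCMMonoid P) (hW : NicaRep W) (hσ : FreePair W σ)
    (h1 : DData W₀ W σ Q₁ D₁) (h2 : DData W₀ W σ Q₂ D₂) {v w : Y}
    (hr : RelP W σ Q₁ Q₂ D₁ D₂ v w) (q : P) :
    RelP W σ Q₁ Q₂ D₁ D₂ (adjoint (W q) v) (adjoint (W q) w) := by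
  cases hr with
  | base p h =>
    exact kill_adj hP hW (A_kill hσ h1 h) (A_kill hσ h2 h) _ .zero (fun s => .base s h) p q
  | step p v w hr =>
    exact kill_adj hP hW (hσ.kill _) (hσ.kill _) _ .zero (fun s => .step s _ _ hr) p q

theorem RelP.tau {v w : Y} (hr : RelP W σ Q₁ Q₂ D₁ D₂ v w) :
    RelP W σ Q₁ Q₂ D₁ D₂ (σ (σ v)) (σ (σ w)) := by
  have := RelP.step 1 v w hr
  rwa [hom_one_apply, hom_one_apply] at this

theorem RelP.adjtau (hσ : FreePair W σ)
    (h1 : DData W₀ W σ Q₁ D₁) (h2 : DData W₀ W σ Q₂ D₂) {v w : Y}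
    (hr : RelP W σ Q₁ Q₂ D₁ D₂ v w) :
    RelP W σ Q₁ Q₂ D₁ D₂ (adjoint σ (adjoint σ v)) (adjoint σ (adjoint σ w)) := by
  cases hr with
  | base p h => rw [tau_A hσ h1 h2, tau_A hσ h2 h1]; exact .zero
  | step p v w hr =>
    by_cases hp : p = 1
    · subst hp
      rw [hom_one_apply, hom_one_apply, hσ.iso, hσ.iso, hσ.iso, hσ.iso]
      exact hr
    · rw [hσ.ne_one p hp, hσ.ne_one p hp, map_zero]
      exact .zero

/-- Properties of the partial isometry `g`. -/
structure GData (W : P →* (Y →L[ℂ] Y)) (σ : Y →L[ℂ] Y) (Q₁ Q₂ : L →L[ℂ] L) (D₁ D₂ : L →L[ℂ] Y)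
    (g : Y →L[ℂ] Y) : Prop where
  map : ∀ h, g (D₁ (Q₂ h) + σ (D₂ h)) = D₂ (Q₁ h) + σ (D₁ h)
  adj : ∀ h, adjoint g (D₂ (Q₁ h) + σ (D₁ h)) = D₁ (Q₂ h) + σ (D₂ h)
  ggg : ∀ x, g (adjoint g (g x)) = g x
  commW : ∀ p x, g (W p x) = W p (g x)
  commtau : ∀ x, g (σ (σ x)) = σ (σ (g x))
  adj_commW : ∀ p x, adjoint g (W p x) = W p (adjoint g x)
  adj_commtau : ∀ x, adjoint g (σ (σ x)) = σ (σ (adjoint g x))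

theorem gdata_exists (hP : IsRightLCMMonoid P) (hW : NicaRep W) (hσ : FreePair W σ)
    (h1 : DData W₀ W σ Q₁ D₁) (h2 : DData W₀ W σ Q₂ D₂) (hQ : ∀ x, Q₁ (Q₂ x) = Q₂ (Q₁ x)) :
    ∃ g, GData W σ Q₁ Q₂ D₁ D₂ g := by
  let I := {x : Y × Y // RelP W σ Q₁ Q₂ D₁ D₂ x.1 x.2}
  obtain ⟨g, hg⟩ := gram_exists' (fun i : I => i.1.1) (fun i : I => i.1.2)
    (fun i j => RelP.gram hP hW hσ h1 h2 hQ i.2 j.2)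
  have hb : ∀ h, RelP W σ Q₁ Q₂ D₁ D₂ (D₁ (Q₂ h) + σ (D₂ h)) (D₂ (Q₁ h) + σ (D₁ h)) := by
    intro h
    have := RelP.base (W := W) (σ := σ) (Q₁ := Q₁) (Q₂ := Q₂) (D₁ := D₁) (D₂ := D₂) 1 h
    rwa [hom_one_apply, hom_one_apply] at this
  have key : ∀ x : Y →L[ℂ] Y,
      (∀ v w, RelP W σ Q₁ Q₂ D₁ D₂ v w → RelP W σ Q₁ Q₂ D₁ D₂ (x v) (x w)) →
      (∀ v w, RelP W σ Q₁ Q₂ D₁ D₂ v w → RelP W σ Q₁ Q₂ D₁ D₂ (adjoint x v) (adjoint x w)) →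
      ∀ y, g (x y) = x (g y) := by
    intro x hx hx' y
    refine hg.comm x (fun i => ⟨⟨(x i.1.1, x i.1.2), hx _ _ i.2⟩, rfl, rfl⟩)
      (fun i => ⟨⟨(adjoint x i.1.1, adjoint x i.1.2), hx' _ _ i.2⟩, rfl⟩) y
  have key' : ∀ x : Y →L[ℂ] Y,
      (∀ v w, RelP W σ Q₁ Q₂ D₁ D₂ v w → RelP W σ Q₁ Q₂ D₁ D₂ (x v) (x w)) →
      (∀ v w, RelP W σ Q₁ Q₂ D₁ D₂ v w → RelP W σ Q₁ Q₂ D₁ D₂ (adjoint x v) (adjoint x w)) →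
      ∀ y, adjoint g (x y) = x (adjoint g y) := by
    intro x hx hx' y
    have h3 := key (adjoint x) hx' (by rw [adjoint_adjoint]; exact hx)
    refine ext_inner_left ℂ fun z => ?_
    rw [adjoint_inner_right, ← adjoint_inner_left, ← h3, ← adjoint_inner_right,
      adjoint_inner_left]
  have t1 : ∀ v w, RelP W σ Q₁ Q₂ D₁ D₂ v w → RelP W σ Q₁ Q₂ D₁ D₂ ((σ ∘L σ) v) ((σ ∘L σ) w) :=
    fun v w hr => hr.tau
  have t2 : ∀ v w, RelP W σ Q₁ Q₂ D₁ D₂ v w →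
      RelP W σ Q₁ Q₂ D₁ D₂ (adjoint (σ ∘L σ) v) (adjoint (σ ∘L σ) w) := by
    intro v w hr
    rw [adjoint_comp]
    exact hr.adjtau hσ h1 h2
  exact ⟨g, fun h => hg.map ⟨(_, _), hb h⟩, fun h => hg.adj ⟨(_, _), hb h⟩, hg.ggg,
    fun p => key (W p) (fun v w hr => RelP.mapW hr p) (fun v w hr => hr.adjW hP hW hσ h1 h2 p),
    fun x => key (σ ∘L σ) t1 t2 x,
    fun p => key' (W p) (fun v w hr => RelP.mapW hr p) (fun v w hr => hr.adjW hP hW hσ h1 h2 p),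
    fun x => key' (σ ∘L σ) t1 t2 x⟩

end Relation

set_option linter.unusedSectionVars false
/-! ## Block operators -/

section Block

variable {E F : Type*} [NormedAddCommGroup E] [InnerProductSpace ℂ E] [CompleteSpace E]
  [NormedAddCommGroup F] [InnerProductSpace ℂ F] [CompleteSpace F]

/-- Pair in the Hilbert sum. -/
def pr (x : E) (y : F) : WithLp 2 (E × F) := WithLp.toLp 2 (x, y)

theorem pr_eta (z : WithLp 2 (E × F)) : ∃ x y, z = pr x y := ⟨z.fst, z.snd, rfl⟩

theorem pr_zero : (pr 0 0 : WithLp 2 (E × F)) = 0 := rfl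

theorem pr_inner (x x' : E) (y y' : F) :
    inner ℂ (pr x y) (pr x' y') = inner ℂ x x' + inner ℂ y y' := rfl

/-- Block operator. -/
noncomputable def blk (a : E →L[ℂ] E) (b : F →L[ℂ] E) (c : E →L[ℂ] F) (d : F →L[ℂ] F) :
    WithLp 2 (E × F) →L[ℂ] WithLp 2 (E × F) :=
  (WithLp.prodContinuousLinearEquiv 2 ℂ E F).symm.toContinuousLinearMap ∘L
    ((a.coprod b).prod (c.coprod d)) ∘L
      (WithLp.prodContinuousLinearEquiv 2 ℂ E F).toContinuousLinearMap

theorem blk_apply (a : E →L[ℂ] E) (b : F →L[ℂ] E) (c : E →L[ℂ] F) (d : F →L[ℂ] F) (x : E) (y : F) :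
    blk a b c d (pr x y) = pr (a x + b y) (c x + d y) := rfl

theorem blk_adj (a : E →L[ℂ] E) (b : F →L[ℂ] E) (c : E →L[ℂ] F) (d : F →L[ℂ] F) :
    adjoint (blk a b c d) = blk (adjoint a) (adjoint c) (adjoint b) (adjoint d) := by
  symm
  rw [eq_adjoint_iff]
  intro z z'
  obtain ⟨x, y, rfl⟩ := pr_eta z
  obtain ⟨x', y', rfl⟩ := pr_eta z'
  rw [blk_apply, blk_apply, pr_inner, pr_inner]
  simp only [inner_add_left, inner_add_right, adjoint_inner_left]
  ring

theorem dsum_apply (a : E →L[ℂ] E) (d : F →L[ℂ] F) (x : E) (y : F) :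
    blk a 0 0 d (pr x y) = pr (a x) (d y) := by
  rw [blk_apply]; simp

theorem dsum_adj_apply (a : E →L[ℂ] E) (d : F →L[ℂ] F) (x : E) (y : F) :
    adjoint (blk a 0 0 d) (pr x y) = pr (adjoint a x) (adjoint d y) := by
  rw [blk_adj, blk_apply]; simp

variable {P : Type*} [Monoid P]

/-- Direct sum of representations. -/
noncomputable def dsumHom (W : P →* (E →L[ℂ] E)) (W' : P →* (F →L[ℂ] F)) :
    P →* (WithLp 2 (E × F) →L[ℂ] WithLp 2 (E × F)) where
  toFun p := blk (W p) 0 0 (W' p)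
  map_one' := by
    ext z
    obtain ⟨x, y, rfl⟩ := pr_eta z
    rw [dsum_apply, hom_one_apply, hom_one_apply]; rfl
  map_mul' p q := by
    ext z
    obtain ⟨x, y, rfl⟩ := pr_eta z
    rw [mul_def, comp_apply, dsum_apply, dsum_apply, dsum_apply, hom_mul_apply, hom_mul_apply]

theorem dsumHom_apply (W : P →* (E →L[ℂ] E)) (W' : P →* (F →L[ℂ] F)) (p : P) (x : E) (y : F) :
    dsumHom W W' p (pr x y) = pr (W p x) (W' p y) := dsum_apply _ _ _ _

theorem dsumHom_adj (W : P →* (E →L[ℂ] E)) (W' : P →* (F →L[ℂ] F)) (p : P) (x : E) (y : F) :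
    adjoint (dsumHom W W' p) (pr x y) = pr (adjoint (W p) x) (adjoint (W' p) y) :=
  dsum_adj_apply _ _ _ _

theorem NicaRep.dsum {W : P →* (E →L[ℂ] E)} {W' : P →* (F →L[ℂ] F)} (h : NicaRep W)
    (h' : NicaRep W') : NicaRep (dsumHom W W') := by
  refine ⟨fun p z => ?_, fun p q hd z => ?_, fun p q r a b hl z => ?_⟩ <;>
    obtain ⟨x, y, rfl⟩ := pr_eta z
  · rw [dsumHom_apply, dsumHom_adj, h.iso, h'.iso]
  · rw [dsumHom_apply, dsumHom_adj, h.disj p q hd, h'.disj p q hd, pr_zero]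
  · rw [dsumHom_apply, dsumHom_adj, h.lcm p q r a b hl, h'.lcm p q r a b hl, dsumHom_adj,
      dsumHom_apply]

theorem FreePair.dsum {W : P →* (E →L[ℂ] E)} {W' : P →* (F →L[ℂ] F)} {V : E →L[ℂ] E}
    {V' : F →L[ℂ] F} (h : FreePair W V)
    (h' : FreePair W' V') : FreePair (dsumHom W W') (blk V 0 0 V') := by
  refine ⟨fun z => ?_, fun p hp z => ?_, fun p hp z => ?_⟩ <;>
    obtain ⟨x, y, rfl⟩ := pr_eta z
  · rw [dsum_apply, dsum_adj_apply, h.iso, h'.iso]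
  · rw [dsumHom_apply, dsum_adj_apply, h.nonunit p hp, h'.nonunit p hp, pr_zero]
  · rw [dsum_apply, dsumHom_apply, dsum_adj_apply, h.ne_one p hp, h'.ne_one p hp, pr_zero]

/-- First inclusion. -/
noncomputable def inc1 : E →ₗᵢ[ℂ] WithLp 2 (E × F) where
  toFun x := pr x 0
  map_add' x y := by
    change WithLp.toLp 2 (x + y, (0 : F)) = WithLp.toLp 2 (x + y, (0 : F) + 0)
    rw [add_zero]
  map_smul' c x := by
    change WithLp.toLp 2 (c • x, (0 : F)) = WithLp.toLp 2 (c • x, c • (0 : F))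
    rw [smul_zero]
  norm_map' x := by
    change ‖pr x (0 : F)‖ = ‖x‖
    have : ‖pr x (0 : F)‖ ^ 2 = ‖x‖ ^ 2 := by
      rw [@norm_sq_eq_re_inner ℂ, @norm_sq_eq_re_inner ℂ _ _ _ _ x, pr_inner, inner_zero_left,
        add_zero]
    exact (pow_left_inj₀ (norm_nonneg _) (norm_nonneg _) two_ne_zero).1 this

theorem inc1_apply (x : E) : (inc1 x : WithLp 2 (E × F)) = pr x 0 := rfl

end Block

/-! ## Doubling -/

section Dbl

variable {P : Type*} [Monoid P] {L Y : Type*} [NormedAddCommGroup L]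
    [InnerProductSpace ℂ L] [CompleteSpace L] [NormedAddCommGroup Y]
    [InnerProductSpace ℂ Y] [CompleteSpace Y]
variable {W₀ : P →* (L →L[ℂ] L)} {W : P →* (Y →L[ℂ] Y)} {σ : Y →L[ℂ] Y} {Q Q₁ Q₂ : L →L[ℂ] L}
  {D D₁ D₂ : L →L[ℂ] Y}

/-- Doubled defect operator. -/
noncomputable def dbl (D : L →L[ℂ] Y) : L →L[ℂ] WithLp 2 (Y × Y) :=
  (inc1 : Y →ₗᵢ[ℂ] WithLp 2 (Y × Y)).toContinuousLinearMap ∘L D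

theorem dbl_apply (D : L →L[ℂ] Y) (l : L) : dbl D l = pr (D l) 0 := rfl

theorem DData.dbl (h : DData W₀ W σ Q D) :
    DData W₀ (dsumHom W W) (blk σ 0 0 σ) Q (dbl D) := by
  refine ⟨fun x y => ?_, fun p hp x y => ?_, fun l p hp => ?_, fun p l => ?_⟩
  · rw [dbl_apply, dbl_apply, pr_inner, h.gram1, inner_zero_left, add_zero]
  · rw [dbl_apply, dbl_apply, dsumHom_apply, pr_inner, h.gram p hp, inner_zero_left, add_zero]
  · rw [dbl_apply, dsumHom_adj, h.kill l p hp, map_zero, pr_zero]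
  · rw [dbl_apply, dsumHom_apply, dsum_adj_apply, h.sig, map_zero, map_zero, pr_zero]

/-- Properties of the unitary. -/
structure UData (W : P →* (Y →L[ℂ] Y)) (σ : Y →L[ℂ] Y) (Q₁ Q₂ : L →L[ℂ] L) (D₁ D₂ : L →L[ℂ] Y)
    (G : Y →L[ℂ] Y) : Prop where
  map : ∀ h, G (D₁ (Q₂ h) + σ (D₂ h)) = D₂ (Q₁ h) + σ (D₁ h)
  adj_self : ∀ x, adjoint G (G x) = x
  self_adj : ∀ x, G (adjoint G x) = x
  commW : ∀ p x, G (W p x) = W p (G x)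
  commtau : ∀ x, G (σ (σ x)) = σ (σ (G x))

theorem GData.adj_ggg {g : Y →L[ℂ] Y} (h : GData W σ Q₁ Q₂ D₁ D₂ g) (x : Y) :
    adjoint g (g (adjoint g x)) = adjoint g x := by
  refine ext_inner_left ℂ fun z => ?_
  rw [adjoint_inner_right, ← adjoint_inner_left g, ← adjoint_inner_left (adjoint g),
    adjoint_adjoint, h.ggg, adjoint_inner_right]

theorem udata_exists {g : Y →L[ℂ] Y} (h : GData W σ Q₁ Q₂ D₁ D₂ g) :
    ∃ G, UData (dsumHom W W) (blk σ 0 0 σ) Q₁ Q₂ (dbl D₁) (dbl D₂) G := by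
  let G := blk g (1 - g ∘L adjoint g) (1 - adjoint g ∘L g) (- adjoint g)
  have hG : ∀ x y, G (pr x y) = pr (g x + (y - g (adjoint g y)))
      ((x - adjoint g (g x)) + - adjoint g y) := fun x y => rfl
  have hG' : ∀ x y, adjoint G (pr x y) = pr (adjoint g x + (y - adjoint g (g y)))
      ((x - g (adjoint g x)) + - g y) := by
    intro x y
    have : adjoint G = blk (adjoint g) (1 - adjoint g ∘L g) (1 - g ∘L adjoint g) (- g) := by
      simp only [G, blk_adj, map_sub, map_neg, adjoint_comp, adjoint_adjoint, one_def, adjoint_id]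
    rw [this]; rfl
  have hs : ∀ x y x' y' : Y, pr x y + pr x' y' = pr (x + x') (y + y') := fun _ _ _ _ => rfl
  refine ⟨G, fun l => ?_, fun z => ?_, fun z => ?_, fun p z => ?_, fun z => ?_⟩
  · simp only [dbl_apply, dsum_apply, hs, map_zero, add_zero]
    rw [hG, h.map, h.adj]
    simp
  · obtain ⟨x, y, rfl⟩ := pr_eta z
    rw [hG, hG']
    simp only [map_add, map_sub, map_neg, h.ggg, h.adj_ggg]
    congr 1 <;> abel
  · obtain ⟨x, y, rfl⟩ := pr_eta z
    rw [hG', hG]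
    simp only [map_add, map_sub, map_neg, h.ggg, h.adj_ggg]
    congr 1 <;> abel
  · obtain ⟨x, y, rfl⟩ := pr_eta z
    rw [dsumHom_apply, hG, hG, dsumHom_apply]
    simp only [map_add, map_sub, map_neg, h.commW, h.adj_commW]
  · obtain ⟨x, y, rfl⟩ := pr_eta z
    rw [dsum_apply, dsum_apply, hG, hG, dsum_apply, dsum_apply]
    simp only [map_add, map_sub, map_neg, h.commtau, h.adj_commtau]

end Dbl

/-! ## The final isometries -/

section Fin

variable {P : Type*} [Monoid P] {L Y : Type*} [NormedAddCommGroup L]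
    [InnerProductSpace ℂ L] [CompleteSpace L] [NormedAddCommGroup Y]
    [InnerProductSpace ℂ Y] [CompleteSpace Y]
variable {W₀ : P →* (L →L[ℂ] L)} {W : P →* (Y →L[ℂ] Y)} {σ : Y →L[ℂ] Y} {Q Q₁ Q₂ : L →L[ℂ] L}
  {D D₁ D₂ : L →L[ℂ] Y}

theorem freePair_of_inner {V : L →L[ℂ] L} (h1 : ∀ x y, inner ℂ (V x) (V y) = inner ℂ x y)
    (h2 : ∀ p, ¬ IsUnit p → ∀ x, adjoint (W₀ p) (V x) = 0)
    (h3 : ∀ p, p ≠ 1 → ∀ x y, inner ℂ (V x) (W₀ p (V y)) = 0) : FreePair W₀ V := by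
  refine ⟨fun x => ?_, fun p hp x => ?_, fun p hp x => ?_⟩ <;>
    refine ext_inner_left ℂ fun z => ?_ <;> rw [adjoint_inner_right]
  · exact h1 _ _
  · rw [← adjoint_inner_left, h2 p hp, inner_zero_left, inner_zero_right]
  · rw [h3 p hp, inner_zero_right]

theorem free_final (hW : NicaRep W) (hσ : FreePair W σ) (hk : ∀ x, Kill W₀ (Q x))
    (h : DData W₀ W σ Q D) : FreePair (dsumHom W₀ W) (blk Q 0 D σ) := by
  have hb : ∀ x y, blk Q 0 D σ (pr x y) = pr (Q x) (D x + σ y) := by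
    intro x y; rw [blk_apply]; simp
  refine freePair_of_inner (fun z z' => ?_) (fun p hp z => ?_) (fun p hp z z' => ?_) <;>
    obtain ⟨x, y, rfl⟩ := pr_eta z
  · obtain ⟨x', y', rfl⟩ := pr_eta z'
    have e1 := h.sig_left hW 1 x y'
    have e2 := h.sig_right 1 x' y
    rw [hom_one_apply] at e1 e2
    rw [hb, hb, pr_inner, pr_inner, inner_add_left, inner_add_right, inner_add_right, h.gram1,
      e1, e2, hσ.inner_iso]
    ring
  · rw [hb, dsumHom_adj, hk x p hp, map_add, h.kill x p hp, hσ.kill y p hp, add_zero, pr_zero]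
  · obtain ⟨x', y', rfl⟩ := pr_eta z'
    rw [hb, hb, dsumHom_apply, pr_inner, map_add, inner_add_left, inner_add_right,
      inner_add_right, h.gram p hp, h.sig_left hW, h.sig_right, hσ.inner_ne hp]
    ring

theorem FreePair.unitary_left {V Γ : L →L[ℂ] L} (h : FreePair W₀ V)
    (hΓ : ∀ x, adjoint Γ (Γ x) = x)
    (hc' : ∀ p x, adjoint Γ (W₀ p x) = W₀ p (adjoint Γ x)) : FreePair W₀ (Γ ∘L V) := by
  refine ⟨fun x => ?_, fun p hp x => ?_, fun p hp x => ?_⟩ <;>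
    rw [adjoint_comp] <;> simp only [comp_apply]
  · rw [hΓ, h.iso]
  · rw [hc', h.nonunit p hp]
  · rw [hc', hΓ, h.ne_one p hp]

theorem FreePair.unitary_right {V Γ : L →L[ℂ] L} (h : FreePair W₀ V)
    (hΓ : ∀ x, adjoint Γ (Γ x) = x) : FreePair W₀ (V ∘L Γ) := by
  refine ⟨fun x => ?_, fun p hp x => ?_, fun p hp x => ?_⟩ <;>
    rw [adjoint_comp] <;> simp only [comp_apply]
  · rw [h.iso, hΓ]
  · rw [h.nonunit p hp, map_zero]
  · rw [h.ne_one p hp, map_zero]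

theorem UData.adj_commW {G : Y →L[ℂ] Y} (h : UData W σ Q₁ Q₂ D₁ D₂ G) (p : P) (x : Y) :
    adjoint G (W p x) = W p (adjoint G x) := by
  conv_lhs => rw [← h.self_adj x, ← h.commW, h.adj_self]

variable {H : Type*} [NormedAddCommGroup H] [InnerProductSpace ℂ H] [CompleteSpace H]

theorem final_step {T : P →* (H →L[ℂ] H)} {S₁ S₂ : H →L[ℂ] H} {ι₀ : H →ₗᵢ[ℂ] L}
    {G : Y →L[ℂ] Y} (hW₀ : NicaRep W₀) (hW : NicaRep W) (hσ : FreePair W σ)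
    (k1 : ∀ x, Kill W₀ (Q₁ x)) (k2 : ∀ x, Kill W₀ (Q₂ x))
    (h1 : DData W₀ W σ Q₁ D₁) (h2 : DData W₀ W σ Q₂ D₂) (hQ : ∀ x, Q₁ (Q₂ x) = Q₂ (Q₁ x))
    (hG : UData W σ Q₁ Q₂ D₁ D₂ G) (c1 : Coext ι₀ Q₁ S₁) (c2 : Coext ι₀ Q₂ S₂)
    (cW : ∀ p, Coext ι₀ (W₀ p) (T p)) :
    ∃ (U₁ U₂ : WithLp 2 (L × Y) →L[ℂ] WithLp 2 (L × Y)), U₁ * U₂ = U₂ * U₁ ∧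
      NicaRep (dsumHom W₀ W) ∧ FreePair (dsumHom W₀ W) U₁ ∧ FreePair (dsumHom W₀ W) U₂ ∧
      Coext (inc1.comp ι₀) U₁ S₁ ∧ Coext (inc1.comp ι₀) U₂ S₂ ∧
      ∀ p, Coext (inc1.comp ι₀) (dsumHom W₀ W p) (T p) := by
  have hb : ∀ (Q : L →L[ℂ] L) (D : L →L[ℂ] Y) x y,
      blk Q 0 D σ (pr x y) = pr (Q x) (D x + σ y) := by
    intro Q D x y; rw [blk_apply]; simp
  have hb' : ∀ (Q : L →L[ℂ] L) (D : L →L[ℂ] Y) x,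
      adjoint (blk Q 0 D σ) (pr x 0) = pr (adjoint Q x) 0 := by
    intro Q D x; rw [blk_adj, blk_apply]; simp
  have hi : ∀ h, (inc1.comp ι₀ : H →ₗᵢ[ℂ] WithLp 2 (L × Y)) h = pr (ι₀ h) 0 := fun h => rfl
  refine ⟨blk 1 0 0 G ∘L blk Q₁ 0 D₁ σ, blk Q₂ 0 D₂ σ ∘L blk 1 0 0 (adjoint G), ?_,
    hW₀.dsum hW, (free_final hW hσ k1 h1).unitary_left ?_ ?_,
    (free_final hW hσ k2 h2).unitary_right ?_, fun h => ?_, fun h => ?_, fun p h => ?_⟩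
  · ext z
    obtain ⟨x, y, rfl⟩ := pr_eta z
    simp only [mul_def, comp_apply, dsum_apply, hb, one_def, id_apply]
    rw [hG.adj_self, map_add σ, ← add_assoc, map_add G, hG.map, hG.commtau, hG.self_adj, hQ, map_add σ,
      add_assoc]
  · intro z
    obtain ⟨x, y, rfl⟩ := pr_eta z
    rw [dsum_apply, dsum_adj_apply, hG.adj_self, one_def, adjoint_id]; rfl
  · intro p z
    obtain ⟨x, y, rfl⟩ := pr_eta z
    rw [dsum_adj_apply, dsumHom_apply, dsumHom_apply, dsum_adj_apply, hG.adj_commW, one_def,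
      adjoint_id]; rfl
  · intro z
    obtain ⟨x, y, rfl⟩ := pr_eta z
    rw [dsum_apply, dsum_adj_apply, adjoint_adjoint, hG.self_adj, one_def, adjoint_id]; rfl
  · rw [hi, hi, adjoint_comp, comp_apply, dsum_adj_apply, map_zero, hb', one_def, adjoint_id,
      id_apply, c1]
  · rw [hi, hi, adjoint_comp, comp_apply, hb', dsum_adj_apply, map_zero, one_def, adjoint_id,
      id_apply, c2]
  · rw [hi, hi, dsumHom_adj, map_zero, cW]

end Fin

theorem ando_type_dilation_free_prod {P : Type u} [Monoid P] [Countable P]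
    (hP : IsRightLCMMonoid P)
    {H : Type u} [NormedAddCommGroup H] [InnerProductSpace ℂ H] [CompleteSpace H]
    [TopologicalSpace.SeparableSpace H]
    (T : P →* (H →L[ℂ] H)) (hTcontr : ∀ p : P, ‖T p‖ ≤ 1)
    (S₁ S₂ : H →L[ℂ] H) (hS₁ : ‖S₁‖ ≤ 1) (hS₂ : ‖S₂‖ ≤ 1)
    (hScomm : S₁ * S₂ = S₂ * S₁)
    (hreg₁ : HasStarRegularDilation
      (fun x : Monoid.Coprod (Multiplicative ℕ) P =>
        Monoid.Coprod.lift (powersHom (H →L[ℂ] H) S₁) T x))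
    (hreg₂ : HasStarRegularDilation
      (fun x : Monoid.Coprod (Multiplicative ℕ) P =>
        Monoid.Coprod.lift (powersHom (H →L[ℂ] H) S₂) T x)) :
    ∃ (L : Type u) (_ : NormedAddCommGroup L) (_ : InnerProductSpace ℂ L) (_ : CompleteSpace L)
      (ι : H →ₗᵢ[ℂ] L) (V₁ V₂ : L →L[ℂ] L) (hVcomm : V₁ * V₂ = V₂ * V₁)
      (W : P →* (L →L[ℂ] L)),
      -- V₁, V₂ are commuting isometries and W is an isometric Nica-covariant representation
      adjoint V₁ * V₁ = 1 ∧ adjoint V₂ * V₂ = 1 ∧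
      (∀ p : P, adjoint (W p) * W p = 1) ∧ IsNicaCovariant (fun p : P => W p) ∧
      -- (1) (V₁ × V₂) ∗ W is an isometric dilation of (S₁ × S₂) ∗ T:
      -- the compression to H of the image of any element of ℕ² ∗ P agrees
      (∀ x : Monoid.Coprod (Multiplicative (ℕ × ℕ)) P,
        adjoint ι.toContinuousLinearMap ∘L
            (Monoid.Coprod.lift (pairHom V₁ V₂ hVcomm) W x ∘L ι.toContinuousLinearMap) =
          Monoid.Coprod.lift (pairHom S₁ S₂ hScomm) T x) ∧
      -- (2) Vᵢ ∗ W is an isometric Nica-covariant co-extension of Sᵢ ∗ T for i = 1, 2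
      (∀ x : Monoid.Coprod (Multiplicative ℕ) P,
        adjoint (Monoid.Coprod.lift (powersHom (L →L[ℂ] L) V₁) W x) *
          Monoid.Coprod.lift (powersHom (L →L[ℂ] L) V₁) W x = 1) ∧
      (∀ x : Monoid.Coprod (Multiplicative ℕ) P,
        adjoint (Monoid.Coprod.lift (powersHom (L →L[ℂ] L) V₂) W x) *
          Monoid.Coprod.lift (powersHom (L →L[ℂ] L) V₂) W x = 1) ∧
      IsNicaCovariant
        (fun x : Monoid.Coprod (Multiplicative ℕ) P =>
          Monoid.Coprod.lift (powersHom (L →L[ℂ] L) V₁) W x) ∧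
      IsNicaCovariant
        (fun x : Monoid.Coprod (Multiplicative ℕ) P =>
          Monoid.Coprod.lift (powersHom (L →L[ℂ] L) V₂) W x) ∧
      (∀ (x : Monoid.Coprod (Multiplicative ℕ) P) (h : H),
        adjoint (Monoid.Coprod.lift (powersHom (L →L[ℂ] L) V₁) W x) (ι h) ∈ Set.range ι) ∧
      (∀ (x : Monoid.Coprod (Multiplicative ℕ) P) (h : H),
        adjoint (Monoid.Coprod.lift (powersHom (L →L[ℂ] L) V₂) W x) (ι h) ∈ Set.range ι) ∧
      (∀ x : Monoid.Coprod (Multiplicative ℕ) P,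
        adjoint ι.toContinuousLinearMap ∘L
            (Monoid.Coprod.lift (powersHom (L →L[ℂ] L) V₁) W x ∘L ι.toContinuousLinearMap) =
          Monoid.Coprod.lift (powersHom (H →L[ℂ] H) S₁) T x) ∧
      (∀ x : Monoid.Coprod (Multiplicative ℕ) P,
        adjoint ι.toContinuousLinearMap ∘L
            (Monoid.Coprod.lift (powersHom (L →L[ℂ] L) V₂) W x ∘L ι.toContinuousLinearMap) =
          Monoid.Coprod.lift (powersHom (H →L[ℂ] H) S₂) T x) := by
  obtain ⟨K₁, i1, i2, i3, ι₁, X₁, hX₁⟩ := preg_of_reg (repM T S₁) hreg₁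
  obtain ⟨K₂, j1, j2, j3, ι₂, X₂, hX₂⟩ := preg_of_reg (repM T S₂) hreg₂
  obtain ⟨L, l1, l2, l3, ι₀, W₀, h0, ht⟩ := stepA hX₁.inr
  have hW₀ := h0.nica hP ht
  have cW := h0.coext hP ht
  obtain ⟨Q₁, c1, k1, b1⟩ := stepB hP h0 ht hX₁
  obtain ⟨Q₂, c2, k2, b2⟩ := stepB hP h0 ht hX₂
  have hQ := stepB_comm hScomm hW₀ cW ht c1 c2 k1 k2
  have hF := fockData (L := L) hP
  obtain ⟨Θ₁, t1⟩ := theta_exists hP hW₀ k1 b1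
  obtain ⟨Θ₂, t2⟩ := theta_exists hP hW₀ k2 b2
  obtain ⟨D₁, d1⟩ := ddata_exists hF t1
  obtain ⟨D₂, d2⟩ := ddata_exists hF t2
  obtain ⟨g, hg⟩ := gdata_exists hP hF.nica hF.free d1 d2 hQ
  obtain ⟨G, hG⟩ := udata_exists hg
  obtain ⟨U₁, U₂, hU, n, f1, f2, e1, e2, eW⟩ := final_step hW₀ (hF.nica.dsum hF.nica)
    (hF.free.dsum hF.free) k1 k2 d1.dbl d2.dbl hQ hG c1 c2 cW
  exact ⟨_, inferInstance, inferInstance, inferInstance, _, U₁, U₂, hU, _,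
    final_assembly hP T S₁ S₂ hScomm _ U₁ U₂ hU _ n f1 f2 e1 e2 eW⟩
end

section
/- (Ando's theorem.) Let S₁, S₂ be contractions on a complex Hilbert space H with S₁S₂ = S₂S₁. Then there exist a Hilbert space K containing H as a closed subspace and commuting isometries V₁, V₂ on K such that P_H V₁^n V₂^m|_H = S₁^n S₂^m for all n, m ∈ ℕ, where P_H is the orthogonal projection of K onto H. -/
open ContinuousLinearMap
universe u

namespace AndoAux

lemma exists_defect {H : Type u} [NormedAddCommGroup H] [InnerProductSpace ℂ H]
    [CompleteSpace H] (S : H →L[ℂ] H) (hS : ‖S‖ ≤ 1) :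
    ∃ D : H →L[ℂ] H, ∀ h, ‖S h‖ ^ 2 + ‖D h‖ ^ 2 = ‖h‖ ^ 2 := by
  have key : ∀ (T : H →L[ℂ] H) h, RCLike.re (inner ℂ ((star T * T) h) h) = ‖T h‖ ^ 2 := by
    intro T h
    rw [ContinuousLinearMap.star_eq_adjoint, mul_apply_eq_comp,
      ContinuousLinearMap.adjoint_inner_left]
    exact inner_self_eq_norm_sq (𝕜 := ℂ) _
  have h0 : 0 ≤ 1 - star S * S := by
    rw [ContinuousLinearMap.nonneg_iff_isPositive]
    refine ⟨?_, ?_⟩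
    · have : IsSelfAdjoint (1 - star S * S) := by
        refine IsSelfAdjoint.sub (IsSelfAdjoint.one _) (IsSelfAdjoint.star_mul_self S)
      exact this.isSymmetric
    · intro h
      have hk := key S h
      simp only [ContinuousLinearMap.reApplyInnerSelf, sub_apply, inner_sub_left, map_sub,
        one_apply_eq_self]
      rw [hk, inner_self_eq_norm_sq (𝕜 := ℂ)]
      have : ‖S h‖ ≤ ‖h‖ := by simpa using S.le_of_opNorm_le hS h
      have := pow_le_pow_left₀ (norm_nonneg _) this 2
      linarith
  obtain ⟨D, hD⟩ := CStarAlgebra.nonneg_iff_eq_star_mul_self.1 h0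
  refine ⟨D, fun h => ?_⟩
  rw [← key D, ← hD, ← key S]
  simp only [sub_apply, inner_sub_left, map_sub,
        one_apply_eq_self]
  rw [inner_self_eq_norm_sq (𝕜 := ℂ)]; ring

lemma exists_partial {H G : Type u} [NormedAddCommGroup H] [InnerProductSpace ℂ H]
    [NormedAddCommGroup G] [InnerProductSpace ℂ G] [CompleteSpace G]
    (A B : H →ₗ[ℂ] G) (hAB : ∀ h, ‖A h‖ = ‖B h‖) :
    ∃ c : G →L[ℂ] G, (∀ h, c (A h) = B h) ∧ (∀ h, adjoint c (B h) = A h) ∧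
      (∀ x, c (adjoint c (c x)) = c x) := by
  let M := (LinearMap.range A).topologicalClosure
  have : CompleteSpace M := (LinearMap.range A).isClosed_topologicalClosure.completeSpace_coe
  let e : H →ₗ[ℂ] M := A.codRestrict M
    (fun h => (LinearMap.range A).le_topologicalClosure (LinearMap.mem_range_self A h))
  have he : DenseRange e := by
    intro x
    rw [closure_subtype]
    have hx : (x : G) ∈ closure ((LinearMap.range A : Submodule ℂ G) : Set G) := x.2
    convert hx using 2
    ext y; constructor
    · rintro ⟨_, ⟨h, rfl⟩, rfl⟩; exact ⟨h, rfl⟩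
    · rintro ⟨h, rfl⟩; exact ⟨e h, ⟨h, rfl⟩, rfl⟩
  have heB : ∀ h, ‖B h‖ ≤ 1 * ‖e h‖ := by
    intro h; rw [one_mul, ← hAB]; exact le_of_eq rfl
  let w : M →L[ℂ] G := B.extendOfNorm e
  have hw : ∀ h, w (e h) = B h := fun h => LinearMap.extendOfNorm_eq he ⟨1, heB⟩ h
  have hwn : ∀ x, ‖w x‖ = ‖x‖ := by
    intro x
    refine he.induction_on (p := fun x => ‖w x‖ = ‖x‖) x
      (isClosed_eq (by fun_prop) (by fun_prop)) ?_
    intro h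
    rw [hw, ← hAB]; rfl
  have hww : adjoint w ∘L w = 1 := (norm_map_iff_adjoint_comp_self w).1 hwn
  have hww' : ∀ x, adjoint w (w x) = x := fun x => by
    simpa using congrArg (fun T => T x) hww
  let P := M.orthogonalProjectionOnto
  have hPe : ∀ x : M, P (x : G) = x := fun x => by simp [P]
  have hPa : adjoint P = M.subtypeL := by
    rw [show P = adjoint M.subtypeL from (Submodule.adjoint_subtypeL M).symm, adjoint_adjoint]
  have hca : ∀ y, adjoint (w ∘L P) y = (adjoint w y : G) := by
    intro y
    rw [adjoint_comp, hPa]; rfl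
  refine ⟨w ∘L P, ?_, ?_, ?_⟩
  · intro h
    have : P (A h) = e h := hPe (e h)
    rw [comp_apply, this, hw]
  · intro h
    rw [hca, ← hw, hww']; rfl
  · intro x
    rw [hca]
    simp only [comp_apply]
    rw [hww', hPe]

lemma exists_unitary {H G : Type u} [NormedAddCommGroup H] [InnerProductSpace ℂ H]
    [NormedAddCommGroup G] [InnerProductSpace ℂ G] [CompleteSpace G]
    (A B : H →ₗ[ℂ] G) (hAB : ∀ h, ‖A h‖ = ‖B h‖) :
    ∃ u : WithLp 2 (G × G) ≃ₗᵢ[ℂ] WithLp 2 (G × G),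
      ∀ h, u (WithLp.toLp 2 (A h, 0)) = WithLp.toLp 2 (B h, 0) := by
  obtain ⟨c, hc1, hc2, hc3⟩ := exists_partial A B hAB
  have hc4 : ∀ x, adjoint c (c (adjoint c x)) = adjoint c x := by
    intro x
    refine ext_inner_right ℂ fun y => ?_
    rw [adjoint_inner_left, ← adjoint_inner_right, adjoint_inner_left, hc3, adjoint_inner_left]
  let f : WithLp 2 (G × G) ≃ₗ[ℂ] WithLp 2 (G × G) :=
    { toFun := fun x => WithLp.toLp 2 (c x.fst + (x.snd - c (adjoint c x.snd)),
        (x.fst - adjoint c (c x.fst)) + adjoint c x.snd)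
      invFun := fun x => WithLp.toLp 2 (adjoint c x.fst + (x.snd - adjoint c (c x.snd)),
        (x.fst - c (adjoint c x.fst)) + c x.snd)
      map_add' := fun x y => by
        apply WithLp.ofLp_injective
        ext <;> simp <;> abel
      map_smul' := fun a x => by
        apply WithLp.ofLp_injective
        ext <;> simp [smul_add, smul_sub]
      left_inv := fun x => by
        apply WithLp.ofLp_injective
        ext <;> simp [hc3, hc4]
      right_inv := fun x => by
        apply WithLp.ofLp_injective
        ext <;> simp [hc3, hc4] }
  refine ⟨f.isometryOfInner ?_, ?_⟩
  · intro x y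
    have : ∀ z, inner ℂ (f x) z = inner ℂ x (f.symm z) := by
      intro z
      have e1 : ∀ a b, inner ℂ (c (adjoint c a)) b = inner ℂ a (c (adjoint c b)) := by
        intro a b
        rw [← adjoint_inner_right, adjoint_inner_left]
      simp only [f, e1, WithLp.fst, WithLp.snd, LinearEquiv.coe_mk, LinearMap.coe_mk, AddHom.coe_mk, LinearEquiv.coe_symm_mk', WithLp.prod_inner_apply,
        inner_add_left, inner_sub_left, inner_add_right, inner_sub_right, adjoint_inner_left, adjoint_inner_right]
      ring
    rw [this, f.symm_apply_apply]
  · intro h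
    show f _ = _
    apply WithLp.ofLp_injective
    ext <;> simp [f, hc1, hc2]

lemma exists_lp {W Q : Type u} [AddCommGroup W] [Module ℂ W]
    [NormedAddCommGroup Q] [InnerProductSpace ℂ Q]
    (f : W →ₗ[ℂ] (ℕ → Q)) (r : W → ℝ) (hr : ∀ w, HasSum (fun n => ‖f w n‖ ^ 2) (r w)) :
    ∃ F : W →ₗ[ℂ] lp (fun _ : ℕ => Q) 2, (∀ w n, F w n = f w n) ∧ ∀ w, ‖F w‖ ^ 2 = r w := by
  have hm : ∀ w, Memℓp (f w) 2 := fun w => memℓp_gen (by simpa using (hr w).summable)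
  refine ⟨{ toFun := fun w => ⟨f w, hm w⟩
            map_add' := fun x y => Subtype.ext (map_add f x y)
            map_smul' := fun a x => Subtype.ext (map_smul f a x) }, fun w n => rfl, fun w => ?_⟩
  refine HasSum.unique ?_ (hr w)
  have := lp.hasSum_norm (p := 2) (by norm_num) (⟨f w, hm w⟩ : lp (fun _ : ℕ => Q) 2)
  simpa using this

lemma lp_hasSum {Q : Type u} [NormedAddCommGroup Q] (x : lp (fun _ : ℕ => Q) 2) :
    HasSum (fun n => ‖x n‖ ^ 2) (‖x‖ ^ 2) := by
  simpa using lp.hasSum_norm (p := 2) (by norm_num) x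

abbrev Quad (H : Type u) : Type u := WithLp 2 (WithLp 2 (H × H) × WithLp 2 (H × H))

abbrev Tail (H : Type u) [NormedAddCommGroup H] : Type u := lp (fun _ : ℕ => Quad H) 2

abbrev Dil (H : Type u) [NormedAddCommGroup H] : Type u := WithLp 2 (H × Tail H)

def mk4 {H : Type u} (a b c d : H) : Quad H :=
  WithLp.toLp 2 (WithLp.toLp 2 (a, b), WithLp.toLp 2 (c, d))

def shiftFun {H : Type u} [NormedAddCommGroup H] (e : H) (x : ℕ → Quad H) : ℕ → Quad H
  | 0 => mk4 e (x 0).fst.fst 0 (x 0).snd.fst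
  | n + 1 => mk4 (x n).fst.snd (x (n + 1)).fst.fst (x n).snd.snd (x (n + 1)).snd.fst

lemma norm_quad {H : Type u} [NormedAddCommGroup H] (x : Quad H) :
    ‖x‖ ^ 2 = (‖x.fst.fst‖ ^ 2 + ‖x.snd.fst‖ ^ 2) + (‖x.fst.snd‖ ^ 2 + ‖x.snd.snd‖ ^ 2) := by
  rw [WithLp.prod_norm_sq_eq_of_L2, WithLp.prod_norm_sq_eq_of_L2, WithLp.prod_norm_sq_eq_of_L2]
  ring

lemma norm_mk4 {H : Type u} [NormedAddCommGroup H] (a b c d : H) :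
    ‖mk4 a b c d‖ ^ 2 = (‖b‖ ^ 2 + ‖d‖ ^ 2) + (‖a‖ ^ 2 + ‖c‖ ^ 2) := by
  rw [norm_quad]
  change (‖a‖ ^ 2 + ‖c‖ ^ 2) + (‖b‖ ^ 2 + ‖d‖ ^ 2) = _
  ring

lemma shift_hasSum {H : Type u} [NormedAddCommGroup H] (e : H) (x : Tail H) :
    HasSum (fun n => ‖shiftFun e x n‖ ^ 2) (‖e‖ ^ 2 + ‖x‖ ^ 2) := by
  have hx := lp_hasSum x
  simp only [norm_quad] at hx
  set a : ℕ → ℝ := fun n => ‖(x n).fst.fst‖ ^ 2 + ‖(x n).snd.fst‖ ^ 2 with ha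
  set b : ℕ → ℝ := fun n => ‖(x n).fst.snd‖ ^ 2 + ‖(x n).snd.snd‖ ^ 2 with hb
  have hsa : Summable a := Summable.of_nonneg_of_le (fun n => by positivity)
    (fun n => le_add_of_nonneg_right (by positivity : 0 ≤ b n)) hx.summable
  have hsb : Summable b := Summable.of_nonneg_of_le (fun n => by positivity)
    (fun n => le_add_of_nonneg_left (by positivity : 0 ≤ a n)) hx.summable
  let b' : ℕ → ℝ := fun n => Nat.casesOn n (‖e‖ ^ 2) b
  have hb' : HasSum b' (‖e‖ ^ 2 + ∑' n, b n) := by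
    rw [← hasSum_nat_add_iff' 1]
    simpa [b'] using hsb.hasSum
  have hab := (hsa.hasSum.add hsb.hasSum).unique hx
  have h := hsa.hasSum.add hb'
  convert h using 1
  · ext n
    cases n with
    | zero => simp [shiftFun, norm_mk4, ha, b']
    | succ n => simp only [shiftFun, norm_mk4, ha, hb, b']
  · rw [← hab]; ring

/-- The basic non-commuting isometric dilation. -/
lemma exists_V {H : Type u} [NormedAddCommGroup H] [InnerProductSpace ℂ H]
    (S D : H →L[ℂ] H) (hD : ∀ h, ‖S h‖ ^ 2 + ‖D h‖ ^ 2 = ‖h‖ ^ 2) :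
    ∃ V : Dil H →ₗᵢ[ℂ] Dil H, (∀ k, (V k).fst = S k.fst) ∧
      ∀ k n, (V k).snd n = shiftFun (D k.fst) k.snd n := by
  let f : Dil H →ₗ[ℂ] (ℕ → Quad H) :=
    { toFun := fun k => shiftFun (D k.fst) k.snd
      map_add' := fun x y => by
        ext n
        cases n <;> simp [shiftFun, mk4, ← WithLp.toLp_add]
      map_smul' := fun a x => by
        ext n
        cases n <;> simp [shiftFun, mk4, ← WithLp.toLp_smul] }
  obtain ⟨F, hF, hFn⟩ := exists_lp f (fun k => ‖D k.fst‖ ^ 2 + ‖k.snd‖ ^ 2)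
    (fun k => shift_hasSum _ _)
  refine ⟨⟨{ toFun := fun k => WithLp.toLp 2 (S k.fst, F k)
             map_add' := fun x y => by simp [← WithLp.toLp_add]
             map_smul' := fun a x => by simp [← WithLp.toLp_smul] }, ?_⟩,
    fun k => rfl, fun k n => hF k n⟩
  intro k
  rw [← sq_eq_sq₀ (norm_nonneg _) (norm_nonneg _), WithLp.prod_norm_sq_eq_of_L2,
    WithLp.prod_norm_sq_eq_of_L2 k]
  change ‖S k.fst‖ ^ 2 + ‖F k‖ ^ 2 = _
  rw [hFn, ← hD k.fst]; ring

lemma exists_U {H : Type u} [NormedAddCommGroup H] [InnerProductSpace ℂ H]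
    (u : Quad H →ₗᵢ[ℂ] Quad H) :
    ∃ U : Dil H →ₗᵢ[ℂ] Dil H, (∀ k, (U k).fst = k.fst) ∧ ∀ k n, (U k).snd n = u (k.snd n) := by
  let f : Dil H →ₗ[ℂ] (ℕ → Quad H) :=
    { toFun := fun k n => u (k.snd n)
      map_add' := fun x y => by
        ext n; simp
      map_smul' := fun a x => by
        ext n; simp }
  obtain ⟨F, hF, hFn⟩ := exists_lp f (fun k => ‖k.snd‖ ^ 2)
    (fun k => by simpa [f] using lp_hasSum k.snd)
  refine ⟨⟨{ toFun := fun k => WithLp.toLp 2 (k.fst, F k)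
             map_add' := fun x y => by simp [← WithLp.toLp_add]
             map_smul' := fun a x => by simp [← WithLp.toLp_smul] }, ?_⟩,
    fun k => rfl, fun k n => hF k n⟩
  intro k
  rw [← sq_eq_sq₀ (norm_nonneg _) (norm_nonneg _), WithLp.prod_norm_sq_eq_of_L2,
    WithLp.prod_norm_sq_eq_of_L2 k]
  change ‖k.fst‖ ^ 2 + ‖F k‖ ^ 2 = _
  rw [hFn]

lemma dil_ext {H : Type u} [NormedAddCommGroup H] {x y : Dil H} (h1 : x.fst = y.fst)
    (h2 : ∀ n, x.snd n = y.snd n) : x = y := by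
  apply WithLp.ofLp_injective
  refine Prod.ext h1 ?_
  apply lp.ext
  funext n
  exact h2 n

lemma shift_shift {H : Type u} [NormedAddCommGroup H] (e f : H) (x : ℕ → Quad H) (n : ℕ) :
    shiftFun e (shiftFun f x) n = Nat.casesOn n (mk4 e f 0 0) x := by
  cases n with
  | zero => rfl
  | succ n => cases n <;> rfl

end AndoAux

open AndoAux

/-- Ando's dilation theorem: two commuting contractions on a Hilbert space `H` dilate to a
pair of commuting isometries on a Hilbert space `K ⊇ H` (realized via an isometric
embedding `ι : H → K`), in the sense that
`P_H V₁^n V₂^m |_H = S₁^n S₂^m` for all `n, m ∈ ℕ`. -/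
theorem ando_dilation {H : Type u} [NormedAddCommGroup H] [InnerProductSpace ℂ H]
    [CompleteSpace H]
    (S₁ S₂ : H →L[ℂ] H) (hS₁ : ‖S₁‖ ≤ 1) (hS₂ : ‖S₂‖ ≤ 1) (hcomm : S₁ * S₂ = S₂ * S₁) :
    ∃ (K : Type u) (_ : NormedAddCommGroup K) (_ : InnerProductSpace ℂ K) (_ : CompleteSpace K)
      (ι : H →ₗᵢ[ℂ] K) (V₁ V₂ : K →L[ℂ] K),
      adjoint V₁ * V₁ = 1 ∧ adjoint V₂ * V₂ = 1 ∧ V₁ * V₂ = V₂ * V₁ ∧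
      ∀ n m : ℕ,
        adjoint ι.toContinuousLinearMap ∘L ((V₁ ^ n * V₂ ^ m) ∘L ι.toContinuousLinearMap) =
          S₁ ^ n * S₂ ^ m := by
  have hc : ∀ h, S₁ (S₂ h) = S₂ (S₁ h) := fun h => congrArg (fun T => T h) hcomm
  obtain ⟨D₁, hD₁⟩ := exists_defect S₁ hS₁
  obtain ⟨D₂, hD₂⟩ := exists_defect S₂ hS₂
  obtain ⟨V₁, hV₁, hV₁'⟩ := exists_V S₁ D₁ hD₁
  obtain ⟨V₂, hV₂, hV₂'⟩ := exists_V S₂ D₂ hD₂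
  let A : H →ₗ[ℂ] WithLp 2 (H × H) :=
    { toFun := fun h => WithLp.toLp 2 (D₁ (S₂ h), D₂ h)
      map_add' := fun x y => by simp [← WithLp.toLp_add]
      map_smul' := fun x y => by simp [← WithLp.toLp_smul] }
  let B : H →ₗ[ℂ] WithLp 2 (H × H) :=
    { toFun := fun h => WithLp.toLp 2 (D₂ (S₁ h), D₁ h)
      map_add' := fun x y => by simp [← WithLp.toLp_add]
      map_smul' := fun x y => by simp [← WithLp.toLp_smul] }
  have hAB : ∀ h, ‖A h‖ = ‖B h‖ := by
    intro h
    rw [← sq_eq_sq₀ (norm_nonneg _) (norm_nonneg _), WithLp.prod_norm_sq_eq_of_L2,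
      WithLp.prod_norm_sq_eq_of_L2]
    change ‖D₁ (S₂ h)‖ ^ 2 + ‖D₂ h‖ ^ 2 = ‖D₂ (S₁ h)‖ ^ 2 + ‖D₁ h‖ ^ 2
    have h1 := hD₁ (S₂ h)
    have h2 := hD₂ (S₁ h)
    have h3 := hD₁ h
    have h4 := hD₂ h
    rw [hc] at h1
    linarith
  obtain ⟨u, hu⟩ := exists_unitary A B hAB
  have hu' : ∀ h, u (mk4 (D₁ (S₂ h)) (D₂ h) 0 0) = mk4 (D₂ (S₁ h)) (D₁ h) 0 0 := hu
  obtain ⟨U, hU, hU'⟩ := exists_U u.toLinearIsometry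
  obtain ⟨U', hUi, hUi'⟩ := exists_U u.symm.toLinearIsometry
  have hUU : ∀ k, U (U' k) = k := fun k =>
    dil_ext (by rw [hU, hUi]) (fun n => by rw [hU', hUi']; exact u.apply_symm_apply _)
  have hUU' : ∀ k, U' (U k) = k := fun k =>
    dil_ext (by rw [hUi, hU]) (fun n => by rw [hUi', hU']; exact u.symm_apply_apply _)
  have hkey : ∀ k, U (V₁ (V₂ k)) = V₂ (V₁ (U k)) := by
    intro k
    refine dil_ext ?_ ?_
    · rw [hU, hV₁, hV₂, hV₂, hV₁, hU, hc]
    · intro n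
      have e1 : ((V₂ k).snd : ℕ → Quad H) = shiftFun (D₂ k.fst) k.snd := funext (hV₂' k)
      have e2 : ((V₁ (U k)).snd : ℕ → Quad H) = shiftFun (D₁ (U k).fst) (U k).snd :=
        funext (hV₁' _)
      rw [hU', hV₁', e1, hV₂', e2, shift_shift, shift_shift, hV₂, hV₁, hU]
      cases n with
      | zero => exact hu' _
      | succ n => exact (hU' k n).symm
  let ι : H →ₗᵢ[ℂ] Dil H :=
    ⟨{ toFun := fun h => WithLp.toLp 2 (h, 0)
       map_add' := fun x y => by simp [← WithLp.toLp_add]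
       map_smul' := fun x y => by simp [← WithLp.toLp_smul] }, fun h => by
        rw [← sq_eq_sq₀ (norm_nonneg _) (norm_nonneg _), WithLp.prod_norm_sq_eq_of_L2]
        simp⟩
  let W₁ : Dil H →ₗᵢ[ℂ] Dil H := U.comp V₁
  let W₂ : Dil H →ₗᵢ[ℂ] Dil H := V₂.comp U'
  have hW₁ : ∀ k, (W₁ k).fst = S₁ k.fst := fun k => by
    change (U (V₁ k)).fst = _
    rw [hU, hV₁]
  have hW₂ : ∀ k, (W₂ k).fst = S₂ k.fst := fun k => by
    change (V₂ (U' k)).fst = _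
    rw [hV₂, hUi]
  have hp₁ : ∀ n k, ((W₁.toContinuousLinearMap ^ n) k).fst = (S₁ ^ n) k.fst := by
    intro n
    induction n with
    | zero => intro k; rfl
    | succ n ih =>
      intro k
      rw [pow_succ, pow_succ, mul_apply_eq_comp, mul_apply_eq_comp, ih]
      exact congrArg _ (hW₁ k)
  have hp₂ : ∀ n k, ((W₂.toContinuousLinearMap ^ n) k).fst = (S₂ ^ n) k.fst := by
    intro n
    induction n with
    | zero => intro k; rfl
    | succ n ih =>
      intro k
      rw [pow_succ, pow_succ, mul_apply_eq_comp, mul_apply_eq_comp, ih]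
      exact congrArg _ (hW₂ k)
  have hι : ∀ k, adjoint ι.toContinuousLinearMap k = k.fst := by
    intro k
    refine ext_inner_right ℂ fun h => ?_
    rw [adjoint_inner_left, WithLp.prod_inner_apply]
    simp [ι]
  refine ⟨Dil H, inferInstance, inferInstance, inferInstance, ι, W₁.toContinuousLinearMap,
    W₂.toContinuousLinearMap, ?_, ?_, ?_, ?_⟩
  · exact (norm_map_iff_adjoint_comp_self _).1 W₁.norm_map
  · exact (norm_map_iff_adjoint_comp_self _).1 W₂.norm_map
  · ext1 k
    change U (V₁ (V₂ (U' k))) = V₂ (U' (U (V₁ k)))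
    rw [hkey, hUU, hUU']
  · intro n m
    ext1 h
    rw [comp_apply, hι, comp_apply, mul_apply_eq_comp, hp₁, hp₂, mul_apply_eq_comp]
    rfl
end
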